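/- arXiv:2412.08493 — 3 statements merged into one kernel-verified Lean document; each statement's English description precedes it below -/
import Mathlib

section
/- Let Ω ⊆ ℝ^d be open and u ∈ L¹_loc(Ω; ℝ^d). If for every open set A compactly contained in Ω and every y ∈ B₁(0) the difference quotients satisfy sup_{ε < dist(A, ∂Ω)} ‖ε^{-1} y · (u(· + εy) − u(·))‖_{L¹(A)} < ∞, then the distributional symmetric gradient Eu = (∇u + ∇uᵀ)/2 is a locally finite ℝ^{d×d}-valued Radon measure on Ω. -/
open MeasureTheory
open scoped RealInnerProductSpace ContDiff
open Filter Topology CompactlySupported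

lemma integrable_cc_mul {X : Type*} [TopologicalSpace X] [T2Space X] [MeasurableSpace X] [BorelSpace X]
    {m : Measure X} {φ g : X → ℝ} (hφ : Continuous φ) {K : Set X} (hK : IsCompact K)
    (hφK : ∀ x, x ∉ K → φ x = 0) (hg : IntegrableOn g K m) :
    Integrable (fun x => φ x * g x) m := by
  have h1 : IntegrableOn (fun x => φ x * g x) K m := hg.continuousOn_mul hφ.continuousOn hK
  refine (integrableOn_iff_integrable_of_support_subset ?_).1 h1
  intro x hx
  by_contra h
  exact hx (by simp [hφK x h])

lemma riesz_ultra {X ι : Type*} [TopologicalSpace X] [T2Space X] [LocallyCompactSpace X]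
    [MeasurableSpace X] [BorelSpace X] (m : Measure X) (l : Ultrafilter ι) (g : ι → X → ℝ)
    (hg0 : ∀ i x, 0 ≤ g i x)
    (hg : ∀ K : Set X, IsCompact K → ∃ C : ℝ, ∀ᶠ i in (l : Filter ι),
      IntegrableOn (g i) K m ∧ ∫ x in K, g i x ∂m ≤ C) :
    ∃ μ : Measure X, IsFiniteMeasureOnCompacts μ ∧ ∀ φ : C_c(X, ℝ),
      Tendsto (fun i => ∫ x, φ x * g i x ∂m) l (𝓝 (∫ x, φ x ∂μ)) := by
  have hzero : ∀ φ : C_c(X, ℝ), ∀ x, x ∉ tsupport φ → φ x = 0 :=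
    fun φ x hx => image_eq_zero_of_notMem_tsupport hx
  have hint : ∀ φ : C_c(X, ℝ), ∀ᶠ i in (l : Filter ι), Integrable (fun x => φ x * g i x) m := by
    intro φ
    obtain ⟨C, hC⟩ := hg (tsupport φ) φ.hasCompactSupport
    filter_upwards [hC] with i hi
    exact integrable_cc_mul φ.continuous φ.hasCompactSupport (hzero φ) hi.1
  have hlim : ∀ φ : C_c(X, ℝ), ∃ a : ℝ, Tendsto (fun i => ∫ x, φ x * g i x ∂m) l (𝓝 a) := by
    intro φ
    obtain ⟨C, hC⟩ := hg (tsupport φ) φ.hasCompactSupport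
    obtain ⟨M, hM⟩ := φ.hasCompactSupport.exists_bound_of_continuous φ.continuous
    have hb : ∀ᶠ i in (l : Filter ι), (∫ x, φ x * g i x ∂m) ∈ Metric.closedBall (0 : ℝ) (|M| * C) := by
      filter_upwards [hC, hint φ] with i hi hi2
      rw [mem_closedBall_zero_iff]
      have hs : ∫ x, φ x * g i x ∂m = ∫ x in tsupport φ, φ x * g i x ∂m := by
        rw [setIntegral_eq_integral_of_forall_compl_eq_zero]
        intro x hx
        simp [hzero φ x hx]
      rw [hs]
      calc ‖∫ x in tsupport φ, φ x * g i x ∂m‖ ≤ ∫ x in tsupport φ, |M| * g i x ∂m := by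
            refine norm_integral_le_of_norm_le (hi.1.const_mul _) (ae_of_all _ fun x => ?_)
            rw [norm_mul, Real.norm_of_nonneg (hg0 i x)]
            exact mul_le_mul_of_nonneg_right ((hM x).trans (le_abs_self M)) (hg0 i x)
        _ = |M| * ∫ x in tsupport φ, g i x ∂m := integral_const_mul _ _
        _ ≤ |M| * C := mul_le_mul_of_nonneg_left hi.2 (abs_nonneg _)
    obtain ⟨a, -, ha⟩ := (isCompact_closedBall (0 : ℝ) (|M| * C)).ultrafilter_le_nhds
      (l.map fun i => ∫ x, φ x * g i x ∂m) (by
        rw [Filter.le_principal_iff]; exact hb)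
    exact ⟨a, ha⟩
  choose L hL using hlim
  let Λ : C_c(X, ℝ) →ₚ[ℝ] ℝ := PositiveLinearMap.mk₀
    { toFun := L
      map_add' := by
        intro φ ψ
        refine tendsto_nhds_unique (hL _) (((hL φ).add (hL ψ)).congr' ?_)
        filter_upwards [hint φ, hint ψ] with i h1 h2
        rw [← integral_add h1 h2]
        simp [add_mul]
      map_smul' := by
        intro c φ
        refine tendsto_nhds_unique (hL _) (((hL φ).const_mul c).congr' (Eventually.of_forall ?_))
        intro i
        simp only
        rw [← integral_const_mul]
        simp [mul_assoc] } (by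
      intro φ hφ
      refine ge_of_tendsto (hL φ) (Eventually.of_forall fun i => ?_)
      exact integral_nonneg fun x => mul_nonneg (hφ x) (hg0 i x))
  refine ⟨RealRMK.rieszMeasure Λ, inferInstance, fun φ => ?_⟩
  rw [RealRMK.integral_rieszMeasure]
  exact hL φ

lemma weak_limit {d : ℕ} (Ω : Set (EuclideanSpace ℝ (Fin d)))
    (v : EuclideanSpace ℝ (Fin d) → ℝ) (hΩ : IsOpen Ω)
    (hv : LocallyIntegrableOn v Ω volume) (y : EuclideanSpace ℝ (Fin d)) (hy : ‖y‖ < 1)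
    (φ : EuclideanSpace ℝ (Fin d) → ℝ) (hφ : ContDiff ℝ ∞ φ) (hc : HasCompactSupport φ)
    (hs : tsupport φ ⊆ Ω) :
    Tendsto (fun ε : ℝ => ∫ x, φ x * (ε⁻¹ * (v (x + ε • y) - v x))) (𝓝[>] 0)
      (𝓝 (- ∫ x, v x * fderiv ℝ φ x y)) := by
  obtain ⟨δ, hδ, hsub⟩ := IsCompact.exists_cthickening_subset_open hc hΩ hs
  set K' := Metric.cthickening δ (tsupport φ) with hK'
  have hK'c : IsCompact K' := hc.cthickening
  set w := K'.indicator v with hw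
  have hwi : Integrable w := (integrable_indicator_iff hK'c.measurableSet).2
    (hv.integrableOn_compact_subset hsub hK'c)
  have hKK' : tsupport φ ⊆ K' := Metric.self_subset_cthickening _
  have e1 : ∫ x, v x * fderiv ℝ φ x y = ∫ x, w x * fderiv ℝ φ x y := by
    congr 1; ext x
    by_cases hx : x ∈ K'
    · simp [hw, hx]
    · have : fderiv ℝ φ x = 0 := by
        by_contra h
        exact hx (hKK' (support_fderiv_subset ℝ h))
      simp [this]
  rw [e1, ← integral_neg]
  have e2 : ∀ᶠ ε in 𝓝[>] (0 : ℝ), ∫ x, w x * (ε⁻¹ * (φ (x - ε • y) - φ x))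
      = ∫ x, φ x * (ε⁻¹ * (v (x + ε • y) - v x)) := by
    filter_upwards [Ioo_mem_nhdsGT hδ] with ε hε
    obtain ⟨M, hM⟩ := hc.exists_bound_of_continuous hφ.continuous
    have i1 : Integrable (fun x => φ x * w x) :=
      hwi.bdd_mul hφ.continuous.aestronglyMeasurable (ae_of_all _ hM)
    have i2 : Integrable (fun x => φ (x - ε • y) * w x) :=
      hwi.bdd_mul (by have := hφ.continuous; fun_prop) (ae_of_all _ fun x => hM _)
    have i3 : Integrable (fun x => φ x * w (x + ε • y)) :=
      (hwi.comp_add_right (ε • y)).bdd_mul hφ.continuous.aestronglyMeasurable (ae_of_all _ hM)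
    have t : ∫ x, φ x * w (x + ε • y) = ∫ x, φ (x - ε • y) * w x := by
      rw [← integral_add_right_eq_self (fun x => φ (x - ε • y) * w x) (ε • y)]
      simp
    have a1 : ∫ x, w x * (ε⁻¹ * (φ (x - ε • y) - φ x))
        = ε⁻¹ * ((∫ x, φ (x - ε • y) * w x) - ∫ x, φ x * w x) := by
      rw [← integral_sub i2 i1, ← integral_const_mul]
      congr 1; ext x; ring
    have a2 : ∫ x, φ x * (ε⁻¹ * (v (x + ε • y) - v x))
        = ε⁻¹ * ((∫ x, φ x * w (x + ε • y)) - ∫ x, φ x * w x) := by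
      rw [← integral_sub i3 i1, ← integral_const_mul]
      congr 1; ext x
      by_cases hx : x ∈ tsupport φ
      · have h1 : x ∈ K' := hKK' hx
        have h2 : x + ε • y ∈ K' := by
          refine Metric.mem_cthickening_of_dist_le _ x _ _ hx ?_
          simp only [dist_self_add_left, norm_smul, Real.norm_of_nonneg hε.1.le]
          nlinarith [hε.1, hε.2, norm_nonneg y]
        simp only [hw, Set.indicator_of_mem h1, Set.indicator_of_mem h2]; ring
      · simp [image_eq_zero_of_notMem_tsupport hx]
    rw [a1, a2, t]
  refine Tendsto.congr' e2 ?_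
  obtain ⟨C, hC⟩ := (hφ.of_le (by norm_cast) : ContDiff ℝ 1 φ).lipschitzWith_of_hasCompactSupport hc (by norm_num)
  refine tendsto_integral_filter_of_dominated_convergence (fun x => ‖w x‖ * (C * ‖y‖)) ?_ ?_ ?_ ?_
  · refine Eventually.of_forall fun ε => hwi.aestronglyMeasurable.mul ?_
    have := hφ.continuous
    exact Continuous.aestronglyMeasurable (by fun_prop)
  · filter_upwards [self_mem_nhdsWithin] with ε hε
    refine ae_of_all _ fun x => ?_
    have hε : 0 < ε := hε
    rw [norm_mul]
    refine mul_le_mul_of_nonneg_left ?_ (norm_nonneg _)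
    have := hC.dist_le_mul (x - ε • y) x
    rw [dist_eq_norm, dist_eq_norm] at this
    rw [norm_mul, norm_inv, Real.norm_of_nonneg hε.le, inv_mul_le_iff₀ hε]
    refine this.trans (le_of_eq ?_)
    rw [sub_sub_cancel_left, norm_neg, norm_smul, Real.norm_of_nonneg hε.le]; ring
  · exact hwi.norm.mul_const _
  · refine ae_of_all _ fun x => ?_
    rw [← mul_neg]
    refine Tendsto.const_mul _ ?_
    have hd : HasFDerivAt φ (fderiv ℝ φ x) x :=
      ((hφ.differentiable (by simp)) x).hasFDerivAt
    have := (hd.hasLineDerivAt (-y)).tendsto_slope_zero_right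
    simpa [← sub_eq_add_neg] using this

lemma dir_measure {d : ℕ} (Ω : Set (EuclideanSpace ℝ (Fin d))) (hΩ : IsOpen Ω)
    (u : EuclideanSpace ℝ (Fin d) → EuclideanSpace ℝ (Fin d))
    (hu : LocallyIntegrableOn u Ω volume) (y : EuclideanSpace ℝ (Fin d)) (hy : ‖y‖ < 1)
    (hquot : ∀ A : Set (EuclideanSpace ℝ (Fin d)), IsOpen A → IsCompact (closure A) →
      closure A ⊆ Ω →
      ∃ C : ℝ, ∀ ε : ℝ, 0 < ε → Metric.cthickening ε A ⊆ Ω →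
        ∫ x in A, |ε⁻¹ * ⟪y, u (x + ε • y) - u x⟫| ≤ C) :
    ∃ μ ν : Measure (EuclideanSpace ℝ (Fin d)),
      (∀ K : Set (EuclideanSpace ℝ (Fin d)), IsCompact K → K ⊆ Ω → μ K < ⊤ ∧ ν K < ⊤) ∧
      (∀ φ : EuclideanSpace ℝ (Fin d) → ℝ, ContDiff ℝ ∞ φ →
        HasCompactSupport φ → tsupport φ ⊆ Ω →
        (∫ x, φ x ∂μ) - (∫ x, φ x ∂ν) = - ∫ x, ⟪y, u x⟫ * fderiv ℝ φ x y) := by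
  have : LocallyCompactSpace Ω := hΩ.locallyCompactSpace
  have hemb : MeasurableEmbedding (Subtype.val : Ω → EuclideanSpace ℝ (Fin d)) :=
    MeasurableEmbedding.subtype_coe hΩ.measurableSet
  have hv : LocallyIntegrableOn (fun x => ⟪y, u x⟫) Ω volume := by
    intro x hx
    obtain ⟨s, hs, hi⟩ := hu x hx
    exact ⟨s, hs, hi.const_inner y⟩
  let l : Ultrafilter ℝ := Ultrafilter.of (𝓝[>] (0 : ℝ))
  have hl : (l : Filter ℝ) ≤ 𝓝[>] 0 := Ultrafilter.of_le _
  let f : ℝ → EuclideanSpace ℝ (Fin d) → ℝ := fun ε x => ε⁻¹ * (⟪y, u (x + ε • y)⟫ - ⟪y, u x⟫)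
  have key : ∀ K : Set (EuclideanSpace ℝ (Fin d)), IsCompact K → K ⊆ Ω →
      ∃ C : ℝ, ∀ᶠ ε in (l : Filter ℝ), IntegrableOn (f ε) K ∧ ∫ x in K, |f ε x| ≤ C := by
    intro K hK hKΩ
    obtain ⟨A, hA, hKA, hAΩ, hAc⟩ := exists_open_between_and_isCompact_closure hK hΩ hKΩ
    obtain ⟨C, hC⟩ := hquot A hA hAc hAΩ
    obtain ⟨δ, hδ, hsub⟩ := hAc.exists_cthickening_subset_open hΩ hAΩ
    refine ⟨C, hl ?_⟩
    filter_upwards [Ioo_mem_nhdsGT hδ] with ε hε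
    set K' := Metric.cthickening δ (closure A) with hK'
    have hK'c : IsCompact K' := hAc.cthickening
    have hvi := hv.integrableOn_compact_subset hsub hK'c
    have hAK' : A ⊆ K' := subset_closure.trans (Metric.self_subset_cthickening _)
    have hwi := ((integrable_indicator_iff hK'c.measurableSet).2 hvi).comp_add_right (ε • y)
    have h1 : IntegrableOn (fun x => ⟪y, u (x + ε • y)⟫) A := by
      refine (hwi.integrableOn (s := A)).congr_fun ?_ hA.measurableSet
      intro x hx
      have h2 : x + ε • y ∈ K' := by
        refine Metric.mem_cthickening_of_dist_le _ x _ _ (subset_closure hx) ?_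
        simp only [dist_self_add_left, norm_smul, Real.norm_of_nonneg hε.1.le]
        nlinarith [hε.1, hε.2, norm_nonneg y]
      simp [Set.indicator_of_mem h2]
    have h2 : IntegrableOn (f ε) A := (h1.sub (hvi.mono_set hAK')).const_mul ε⁻¹
    refine ⟨h2.mono_set hKA, ?_⟩
    have h3 := hC ε hε.1 (by
      rw [← Metric.cthickening_closure]
      exact (Metric.cthickening_mono hε.2.le _).trans hsub)
    simp only [inner_sub_right] at h3
    refine le_trans ?_ h3
    exact setIntegral_mono_set h2.abs (ae_of_all _ fun x => abs_nonneg _) (LE.le.eventuallyLE hKA)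
  -- transfer to the subtype
  have key2 : ∀ s : ℝ, |s| = 1 → ∀ K : Set Ω, IsCompact K → ∃ C : ℝ, ∀ᶠ ε in (l : Filter ℝ),
      IntegrableOn (fun x : Ω => max (s * f ε x) 0) K (volume.comap Subtype.val) ∧
        ∫ x in K, max (s * f ε x) 0 ∂(volume.comap Subtype.val) ≤ C := by
    intro s hs K hK
    have hKi : IsCompact (Subtype.val '' K) := hK.image continuous_subtype_val
    obtain ⟨C, hC⟩ := key _ hKi (by rintro _ ⟨x, -, rfl⟩; exact x.2)
    refine ⟨C, ?_⟩
    filter_upwards [hC] with ε hε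
    have hres : (volume.comap Subtype.val : Measure Ω).restrict K
        = ((volume : Measure (EuclideanSpace ℝ (Fin d))).restrict (Subtype.val '' K)).comap Subtype.val := by
      rw [hemb.restrict_comap]
    have hmap : ((volume.comap Subtype.val : Measure Ω).restrict K).map Subtype.val
        = (volume : Measure (EuclideanSpace ℝ (Fin d))).restrict (Subtype.val '' K) := by
      rw [hres, hemb.map_comap, Measure.restrict_restrict hemb.measurableSet_range,
        Set.inter_eq_self_of_subset_right (Set.image_subset_range _ _)]
    have hi : IntegrableOn (fun x => max (s * f ε x) 0) (Subtype.val '' K) :=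
      (hε.1.const_mul s).pos_part
    constructor
    · rw [IntegrableOn, ← hmap, hemb.integrable_map_iff] at hi
      exact hi
    · rw [← hemb.integral_map (fun x => max (s * f ε x) 0), hmap]
      refine le_trans (integral_mono hi hε.1.abs fun x => ?_) hε.2
      refine max_le ?_ (abs_nonneg _)
      calc s * f ε x ≤ |s * f ε x| := le_abs_self _
        _ = |f ε x| := by rw [abs_mul, hs, one_mul]
  obtain ⟨μ, hμ, hμl⟩ := riesz_ultra (volume.comap Subtype.val : Measure Ω) l
    (fun ε x => max (1 * f ε x) 0) (fun _ _ => le_max_right _ _) (key2 1 (by simp))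
  obtain ⟨ν, hν, hνl⟩ := riesz_ultra (volume.comap Subtype.val : Measure Ω) l
    (fun ε x => max (-1 * f ε x) 0) (fun _ _ => le_max_right _ _) (key2 (-1) (by simp))
  refine ⟨μ.map Subtype.val, ν.map Subtype.val, ?_, ?_⟩
  · intro K hK hKΩ
    rw [hemb.map_apply, hemb.map_apply]
    have : IsCompact (Subtype.val ⁻¹' K : Set Ω) :=
      Topology.IsInducing.subtypeVal.isCompact_preimage' hK (by simpa using hKΩ)
    exact ⟨this.measure_lt_top, this.measure_lt_top⟩
  · intro φ hφ hc hs
    have hpre : IsCompact (Subtype.val ⁻¹' (tsupport φ) : Set Ω) :=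
      Topology.IsInducing.subtypeVal.isCompact_preimage' hc (by simpa using hs)
    let ψ : C_c(Ω, ℝ) :=
      { toFun := fun x => φ x
        continuous_toFun := hφ.continuous.comp continuous_subtype_val
        hasCompactSupport' := HasCompactSupport.intro hpre fun x hx =>
          image_eq_zero_of_notMem_tsupport hx }
    rw [hemb.integral_map, hemb.integral_map]
    have hlim := (hμl ψ).sub (hνl ψ)
    refine tendsto_nhds_unique hlim ?_
    refine Tendsto.congr' ?_ ((weak_limit Ω _ hΩ hv y hy φ hφ hc hs).mono_left hl)
    obtain ⟨_, h1⟩ := key2 1 (by simp) _ hpre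
    obtain ⟨_, h2⟩ := key2 (-1) (by simp) _ hpre
    filter_upwards [h1, h2] with ε h1 h2
    have hz : ∀ x : Ω, x ∉ (Subtype.val ⁻¹' (tsupport φ) : Set Ω) → ψ x = 0 := fun x hx =>
      (image_eq_zero_of_notMem_tsupport hx : φ x = 0)
    have I1 : Integrable (fun x : Ω => ψ x * max (1 * f ε x) 0) (volume.comap Subtype.val) :=
      integrable_cc_mul ψ.continuous hpre hz h1.1
    have I2 : Integrable (fun x : Ω => ψ x * max (-1 * f ε x) 0) (volume.comap Subtype.val) :=
      integrable_cc_mul ψ.continuous hpre hz h2.1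
    rw [← integral_sub I1 I2]
    have e : ∀ x : Ω, ψ x * max (1 * f ε x) 0 - ψ x * max (-1 * f ε x) 0 = φ x * f ε x := by
      intro x
      have : ψ x = φ x := rfl
      rw [this, ← mul_sub]
      congr 1
      rcases le_total (f ε x) 0 with h | h
      · rw [max_eq_right (by linarith), max_eq_left (by linarith)]; ring
      · rw [max_eq_left (by linarith), max_eq_right (by linarith)]; ring
    simp_rw [e]
    rw [integral_subtype_comap hΩ.measurableSet (fun x => φ x * f ε x),
      setIntegral_eq_integral_of_forall_compl_eq_zero]
    intro x hx
    rw [image_eq_zero_of_notMem_tsupport (fun h => hx (hs h)), zero_mul]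

lemma integrable_test {d : ℕ} {Ω : Set (EuclideanSpace ℝ (Fin d))}
    {μ : Measure (EuclideanSpace ℝ (Fin d))}
    (hμ : ∀ K : Set (EuclideanSpace ℝ (Fin d)), IsCompact K → K ⊆ Ω → μ K < ⊤)
    {φ : EuclideanSpace ℝ (Fin d) → ℝ} (hφ : Continuous φ)
    (hc : HasCompactSupport φ) (hs : tsupport φ ⊆ Ω) : Integrable φ μ := by
  have h : IntegrableOn (fun _ => (1 : ℝ)) (tsupport φ) μ :=
    integrableOn_const (hμ _ hc hs).ne
  simpa using integrable_cc_mul hφ hc (fun x hx => image_eq_zero_of_notMem_tsupport hx) h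

theorem stmt2 {d : ℕ} (Ω : Set (EuclideanSpace ℝ (Fin d))) (hΩ : IsOpen Ω)
    (u : EuclideanSpace ℝ (Fin d) → EuclideanSpace ℝ (Fin d))
    (hu : LocallyIntegrableOn u Ω volume)
    (hquot : ∀ A : Set (EuclideanSpace ℝ (Fin d)), IsOpen A → IsCompact (closure A) →
      closure A ⊆ Ω → ∀ y : EuclideanSpace ℝ (Fin d), ‖y‖ < 1 →
      ∃ C : ℝ, ∀ ε : ℝ, 0 < ε → Metric.cthickening ε A ⊆ Ω →
        ∫ x in A, |ε⁻¹ * ⟪y, u (x + ε • y) - u x⟫| ≤ C) :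
    ∃ μ ν : Fin d → Fin d → Measure (EuclideanSpace ℝ (Fin d)),
      (∀ i j, ∀ K : Set (EuclideanSpace ℝ (Fin d)), IsCompact K → K ⊆ Ω →
        μ i j K < ⊤ ∧ ν i j K < ⊤) ∧
      (∀ i j, ∀ φ : EuclideanSpace ℝ (Fin d) → ℝ, ContDiff ℝ ∞ φ →
        HasCompactSupport φ → tsupport φ ⊆ Ω →
        (∫ x, φ x ∂(μ i j)) - (∫ x, φ x ∂(ν i j))
          = -(1 / 2) * ∫ x, (u x i * fderiv ℝ φ x (EuclideanSpace.single j 1)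
              + u x j * fderiv ℝ φ x (EuclideanSpace.single i 1)) ∂volume) := by
  have hE : ∀ i : Fin d, ‖(1/4 : ℝ) • (EuclideanSpace.single i 1 : EuclideanSpace ℝ (Fin d))‖ ≤ 1/4 := by
    intro i
    rw [norm_smul]; simp
  have D := fun (y : EuclideanSpace ℝ (Fin d)) (hy : ‖y‖ < 1) =>
    dir_measure Ω hΩ u hu y hy (fun A h1 h2 h3 => hquot A h1 h2 h3 y hy)
  have D1 := fun i : Fin d => D ((1/4 : ℝ) • EuclideanSpace.single i 1) ((hE i).trans_lt (by norm_num))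
  have D2 := fun i j : Fin d => D ((1/4 : ℝ) • EuclideanSpace.single i 1 + (1/4 : ℝ) • EuclideanSpace.single j 1)
    ((norm_add_le_of_le (hE i) (hE j)).trans_lt (by norm_num))
  choose m n hfin hrep using D1
  choose M N hFin hRep using D2
  refine ⟨fun i j => (8 : NNReal) • (M i j + (n i + n j)), fun i j => (8 : NNReal) • (N i j + (m i + m j)), ?_, ?_⟩
  · intro i j K hK hKΩ
    have a1 := hfin i K hK hKΩ
    have a2 := hfin j K hK hKΩ
    have a3 := hFin i j K hK hKΩ
    simp only [Measure.smul_apply, Measure.add_apply]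
    constructor <;> refine ENNReal.mul_lt_top ENNReal.coe_lt_top ?_ <;> simp [a1, a2, a3]
  · intro i j φ hφ hc hs
    have im := fun i => integrable_test (fun K h1 h2 => (hfin i K h1 h2).1) hφ.continuous hc hs
    have iN := fun i => integrable_test (fun K h1 h2 => (hfin i K h1 h2).2) hφ.continuous hc hs
    have iM := integrable_test (fun K h1 h2 => (hFin i j K h1 h2).1) hφ.continuous hc hs
    have iN2 := integrable_test (fun K h1 h2 => (hFin i j K h1 h2).2) hφ.continuous hc hs
    simp only [integral_smul_nnreal_measure]
    rw [integral_add_measure iM ((iN i).add_measure (iN j)), integral_add_measure (iN i) (iN j),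
      integral_add_measure iN2 ((im i).add_measure (im j)), integral_add_measure (im i) (im j)]
    have r1 := hrep i φ hφ hc hs
    have r2 := hrep j φ hφ hc hs
    have r3 := hRep i j φ hφ hc hs
    have hint : ∀ y z : EuclideanSpace ℝ (Fin d), Integrable (fun x => ⟪y, u x⟫ * fderiv ℝ φ x z) := by
      intro y z
      have hcont : Continuous fun x => fderiv ℝ φ x z :=
        (hφ.continuous_fderiv (by simp)).clm_apply continuous_const
      have hi : IntegrableOn (fun x => ⟪y, u x⟫) (tsupport φ) :=
        (hu.integrableOn_compact_subset hs hc).const_inner y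
      refine (integrable_cc_mul hcont hc ?_ hi).congr (ae_of_all _ fun x => mul_comm _ _)
      intro x hx
      have : fderiv ℝ φ x = 0 := by
        by_contra h
        exact hx (support_fderiv_subset ℝ h)
      simp [this]
    have hint2 : ∀ y z y' z' : EuclideanSpace ℝ (Fin d), Integrable
        (fun x => ⟪y, u x⟫ * fderiv ℝ φ x z - ⟪y', u x⟫ * fderiv ℝ φ x z') :=
      fun y z y' z' => (hint y z).sub (hint y' z')
    have hkey : ∫ x, (u x i * fderiv ℝ φ x (EuclideanSpace.single j 1)
              + u x j * fderiv ℝ φ x (EuclideanSpace.single i 1)) =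
        16 * ((∫ x, ⟪(1/4 : ℝ) • EuclideanSpace.single i 1 + (1/4 : ℝ) • EuclideanSpace.single j 1, u x⟫ *
          fderiv ℝ φ x ((1/4 : ℝ) • EuclideanSpace.single i 1 + (1/4 : ℝ) • EuclideanSpace.single j 1))
          - (∫ x, ⟪(1/4 : ℝ) • EuclideanSpace.single i 1, u x⟫ *
          fderiv ℝ φ x ((1/4 : ℝ) • EuclideanSpace.single i 1))
          - (∫ x, ⟪(1/4 : ℝ) • EuclideanSpace.single j 1, u x⟫ *
          fderiv ℝ φ x ((1/4 : ℝ) • EuclideanSpace.single j 1))) := by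
      rw [← integral_sub (hint _ _) (hint _ _), ← integral_sub (hint2 _ _ _ _) (hint _ _),
        ← integral_const_mul]
      congr 1; ext x
      simp only [inner_add_left, real_inner_smul_left, map_add, map_smul, smul_eq_mul,
        EuclideanSpace.inner_single_left, map_one, one_mul]
      ring
    rw [hkey]
    simp only [NNReal.smul_def, smul_eq_mul, NNReal.coe_ofNat]
    linarith
end

section
/- There exists a constant C > 0 (depending on the mollification kernel and dimension) such that for all ℓ > 0 and all v ∈ BMO(ℝ^d; ℝ^d) ∩ L²_loc, the mollification commutator satisfies ‖v_ℓ ⊗ v_ℓ − (v ⊗ v)_ℓ‖_{L^∞} ≤ C ‖v‖²_{BMO}, where v_ℓ = v * ρ_ℓ with ρ_ℓ a standard mollifier supported in B_ℓ. -/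
open MeasureTheory

/-- Changing the constant in a mean-square oscillation bound. -/
theorem bmo_swap {α : Type*} [MeasurableSpace α] {μ : Measure α} {s : Set α} (hs : μ s ≠ ⊤)
    (f : α → ℝ) (c0 c1 Φ t : ℝ) (hi : IntegrableOn f s μ)
    (hi2 : IntegrableOn (fun y => f y ^ 2) s μ)
    (h1 : ∫ y in s, (f y - c1) ^ 2 ∂μ ≤ Φ * μ.real s)
    (h0 : ∫ y in s, |f y - c0| ∂μ ≤ t * μ.real s) :
    ∫ y in s, (f y - c0) ^ 2 ∂μ ≤ (Φ + t ^ 2) * μ.real s := by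
  have hc : ∀ c : ℝ, IntegrableOn (fun _ => c) s μ := fun c => integrableOn_const hs
  have hsub : ∀ c : ℝ, IntegrableOn (fun y => f y - c) s μ := fun c => hi.sub (hc c)
  have hsq : ∀ c : ℝ, IntegrableOn (fun y => (f y - c) ^ 2) s μ := fun c => by
    have : (fun y => (f y - c) ^ 2) = fun y => f y ^ 2 - 2 * c * f y + c ^ 2 := by
      ext y; ring
    rw [this]
    exact (hi2.sub (hi.const_mul (2 * c))).add (hc _)
  have habs : IntegrableOn (fun y => |f y - c0|) s μ := (hsub c0).abs
  have hadd : IntegrableOn (fun y => (f y - c1) ^ 2 + 2 * |c1 - c0| * |f y - c0|) s μ :=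
    (hsq c1).add (habs.const_mul _)
  have hall : IntegrableOn (fun y => ((f y - c1) ^ 2 + 2 * |c1 - c0| * |f y - c0|)
      - (c1 - c0) ^ 2) s μ := hadd.sub (hc _)
  have key : ∫ y in s, (f y - c0) ^ 2 ∂μ ≤
      ∫ y in s, (((f y - c1) ^ 2 + 2 * |c1 - c0| * |f y - c0|) - (c1 - c0) ^ 2) ∂μ := by
    apply integral_mono (hsq c0) hall
    intro y
    have h := le_abs_self ((c1 - c0) * (f y - c0))
    rw [abs_mul] at h
    simp only
    nlinarith
  have e : ∫ y in s, (((f y - c1) ^ 2 + 2 * |c1 - c0| * |f y - c0|) - (c1 - c0) ^ 2) ∂μ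
      = ∫ y in s, (f y - c1) ^ 2 ∂μ + 2 * |c1 - c0| * ∫ y in s, |f y - c0| ∂μ
        - (c1 - c0) ^ 2 * μ.real s := by
    rw [integral_sub hadd (hc _),
      integral_add (hsq c1) (habs.const_mul _), integral_const_mul, setIntegral_const, smul_eq_mul]
    ring
  have hm : 0 ≤ μ.real s := measureReal_nonneg
  have h3 : 2 * |c1 - c0| * ∫ y in s, |f y - c0| ∂μ ≤ 2 * |c1 - c0| * (t * μ.real s) :=
    mul_le_mul_of_nonneg_left h0 (by positivity)
  have h4 : 0 ≤ (|c1 - c0| - t) ^ 2 * μ.real s := by positivity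
  have h5 : |c1 - c0| ^ 2 = (c1 - c0) ^ 2 := sq_abs _
  nlinarith

theorem bmo_step {d : ℕ} (f : EuclideanSpace ℝ (Fin d) → ℝ)
    (hf : AEStronglyMeasurable f volume) (N : ℝ) (hN : ∀ y, |f y| ≤ N)
    (M : ℝ) (hM : 0 < M) (Φ : ℝ) (hΦ : 0 ≤ Φ)
    (h1 : ∀ (x : EuclideanSpace ℝ (Fin d)) (r : ℝ), 0 < r → ∃ c : ℝ,
      ∫ y in Metric.closedBall x r, |f y - c| ≤ M * volume.real (Metric.closedBall x r))
    (h2 : ∀ (x : EuclideanSpace ℝ (Fin d)) (r : ℝ), 0 < r → ∃ c : ℝ,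
      ∫ y in Metric.closedBall x r, (f y - c) ^ 2 ≤ Φ * volume.real (Metric.closedBall x r)) :
    ∀ (x : EuclideanSpace ℝ (Fin d)) (r : ℝ), 0 < r → ∃ c : ℝ,
      ∫ y in Metric.closedBall x r, (f y - c) ^ 2 ≤
        (Φ / 2 + 6 * (10 ^ d) ^ 2 * M ^ 2) * volume.real (Metric.closedBall x r) := by
  intro x0 R hR
  obtain ⟨V, hV, hvol⟩ : ∃ V : ℝ, 0 < V ∧ ∀ (x : EuclideanSpace ℝ (Fin d)) (r : ℝ), 0 < r →
      volume.real (Metric.closedBall x r) = r ^ d * V := by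
    refine ⟨volume.real (Metric.ball (0 : EuclideanSpace ℝ (Fin d)) 1), ?_, fun x r hr => ?_⟩
    · exact ENNReal.toReal_pos (Metric.measure_ball_pos _ _ one_pos).ne' measure_ball_lt_top.ne
    · rw [Measure.addHaar_real_closedBall _ _ hr.le, finrank_euclideanSpace_fin]
  have hfin : ∀ (x : EuclideanSpace ℝ (Fin d)) (r : ℝ),
      volume (Metric.closedBall x r) ≠ ⊤ := fun x r => measure_closedBall_lt_top.ne
  obtain ⟨c0, hc0⟩ := h1 x0 (2 * R) (by positivity)
  refine ⟨c0, ?_⟩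
  obtain ⟨t, ht⟩ : ∃ t : ℝ, t = 2 * 10 ^ d * M := ⟨_, rfl⟩
  have htpos : 0 < t := by rw [ht]; positivity
  have hN0 : 0 ≤ N := (abs_nonneg _).trans (hN 0)
  have hfm : ∀ s : Set (EuclideanSpace ℝ (Fin d)), volume s ≠ ⊤ → IntegrableOn f s volume :=
    fun s hs => Measure.integrableOn_of_bounded hs hf (M := N)
      (Filter.Eventually.of_forall fun y => by simpa using hN y)
  have hfm2 : ∀ s : Set (EuclideanSpace ℝ (Fin d)), volume s ≠ ⊤ →
      IntegrableOn (fun y => f y ^ 2) s volume :=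
    fun s hs => Measure.integrableOn_of_bounded hs (hf.pow 2) (M := N ^ 2)
      (Filter.Eventually.of_forall fun y => by
        rw [Real.norm_eq_abs, abs_pow]
        exact pow_le_pow_left₀ (abs_nonneg _) (hN y) 2)
  have hgm : AEStronglyMeasurable (fun y => |f y - c0|) volume :=
    (hf.sub aestronglyMeasurable_const).norm
  have hgi : ∀ s : Set (EuclideanSpace ℝ (Fin d)), volume s ≠ ⊤ →
      IntegrableOn (fun y => |f y - c0|) s volume :=
    fun s hs => ((hfm s hs).sub (integrableOn_const hs)).abs
  have hHi : ∀ s : Set (EuclideanSpace ℝ (Fin d)), volume s ≠ ⊤ →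
      IntegrableOn (fun y => (f y - c0) ^ 2) s volume := fun s hs => by
    have : (fun y => (f y - c0) ^ 2) = fun y => f y ^ 2 - 2 * c0 * f y + c0 ^ 2 := by
      ext y; ring
    rw [this]
    exact ((hfm2 s hs).sub ((hfm s hs).const_mul (2 * c0))).add (integrableOn_const hs)
  have hgloc : LocallyIntegrable (fun y => |f y - c0|) volume := by
    rw [locallyIntegrable_iff]
    exact fun k hk => hgi k hk.measure_lt_top.ne
  have hleb := IsUnifLocDoublingMeasure.ae_tendsto_average volume hgloc 1
  -- selection of the stopping radius
  have hsel : ∀ᵐ x : EuclideanSpace ℝ (Fin d), x ∈ Metric.closedBall x0 R → t < |f x - c0| →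
      ∃ r : ℝ, 0 < r ∧ r ≤ R ∧
        t * volume.real (Metric.closedBall x r) ≤ ∫ y in Metric.closedBall x r, |f y - c0| ∧
        ∫ y in Metric.closedBall x (5 * r), |f y - c0| ≤
          t * volume.real (Metric.closedBall x (5 * r)) := by
    filter_upwards [hleb] with x hx hxB hxt
    have hlim : Filter.Tendsto (fun n : ℕ => R * (1 / 5 : ℝ) ^ n) Filter.atTop
        (nhdsWithin 0 (Set.Ioi 0)) := by
      rw [tendsto_nhdsWithin_iff]
      constructor
      · simpa using (tendsto_pow_atTop_nhds_zero_of_lt_one (r := (1 / 5 : ℝ))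
          (by norm_num) (by norm_num)).const_mul R
      · exact Filter.Eventually.of_forall fun n => by
          simp only [Set.mem_Ioi]; positivity
    have hx2 := hx (fun _ : ℕ => x) _ hlim (Filter.Eventually.of_forall fun n => by
      apply Metric.mem_closedBall_self; positivity)
    have hex : ∃ n : ℕ, t * volume.real (Metric.closedBall x (R * (1 / 5 : ℝ) ^ n)) <
        ∫ y in Metric.closedBall x (R * (1 / 5 : ℝ) ^ n), |f y - c0| := by
      obtain ⟨n, hn⟩ := (hx2.eventually_const_lt hxt).exists
      refine ⟨n, ?_⟩
      have hp : 0 < volume.real (Metric.closedBall x (R * (1 / 5 : ℝ) ^ n)) := by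
        rw [hvol _ _ (by positivity)]; positivity
      rw [setAverage_eq, smul_eq_mul, inv_mul_eq_div, lt_div_iff₀ hp] at hn
      exact hn
    classical
    have hspec := Nat.find_spec hex
    have hmin := fun m => Nat.find_min hex (m := m)
    rcases hk : Nat.find hex with _ | k
    · exfalso
      rw [hk] at hspec
      simp only [pow_zero, mul_one] at hspec
      have hsubset : Metric.closedBall x R ⊆ Metric.closedBall x0 (2 * R) := by
        apply Metric.closedBall_subset_closedBall'
        rw [Metric.mem_closedBall] at hxB
        linarith
      have hle : ∫ y in Metric.closedBall x R, |f y - c0| ≤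
          ∫ y in Metric.closedBall x0 (2 * R), |f y - c0| :=
        setIntegral_mono_set (hgi _ (hfin _ _))
          (Filter.Eventually.of_forall fun y => abs_nonneg _)
          (Filter.Eventually.of_forall hsubset)
      rw [hvol _ _ hR] at hspec
      rw [hvol _ _ (by positivity), mul_pow] at hc0
      have h210 : (2 : ℝ) ^ d ≤ 10 ^ d := pow_le_pow_left₀ (by norm_num) (by norm_num) d
      have hpos : 0 < M * (R ^ d * V) := by positivity
      have hpos10 : (0 : ℝ) < 10 ^ d := by positivity
      have : M * (2 ^ d * R ^ d * V) ≤ t * (R ^ d * V) := by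
        rw [ht]
        nlinarith
      linarith
    · rw [hk] at hspec
      have hnot := hmin k (by omega)
      refine ⟨R * (1 / 5 : ℝ) ^ (k + 1), by positivity, ?_, hspec.le, ?_⟩
      · have : (1 / 5 : ℝ) ^ (k + 1) ≤ 1 := pow_le_one₀ (by norm_num) (by norm_num)
        nlinarith
      · have e : 5 * (R * (1 / 5 : ℝ) ^ (k + 1)) = R * (1 / 5 : ℝ) ^ k := by
          rw [pow_succ]; ring
        rw [e]
        exact not_lt.mp hnot
  obtain ⟨T, hT⟩ : ∃ T : Set (EuclideanSpace ℝ (Fin d)), T = {x | x ∈ Metric.closedBall x0 R ∧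
      ∃ r : ℝ, 0 < r ∧ r ≤ R ∧
        t * volume.real (Metric.closedBall x r) ≤ ∫ y in Metric.closedBall x r, |f y - c0| ∧
        ∫ y in Metric.closedBall x (5 * r), |f y - c0| ≤
          t * volume.real (Metric.closedBall x (5 * r))} := ⟨_, rfl⟩
  have hch : ∀ x, ∃ r : ℝ, x ∈ T → (0 < r ∧ r ≤ R ∧
        t * volume.real (Metric.closedBall x r) ≤ ∫ y in Metric.closedBall x r, |f y - c0| ∧
        ∫ y in Metric.closedBall x (5 * r), |f y - c0| ≤
          t * volume.real (Metric.closedBall x (5 * r))) := by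
    intro x
    by_cases hx : x ∈ T
    · have hx' := hx
      rw [hT] at hx'
      obtain ⟨r, hr⟩ := hx'.2
      exact ⟨r, fun _ => hr⟩
    · exact ⟨0, fun h => absurd h hx⟩
  choose r hr using hch
  obtain ⟨u, huT, hdisj, hcov⟩ := Vitali.exists_disjoint_subfamily_covering_enlargement_closedBall
    T (fun x => x) r R (fun a ha => (hr a ha).2.1) 5 (by norm_num)
  have hucount : u.Countable := hdisj.countable_of_nonempty_interior fun a ha =>
    ⟨a, Metric.ball_subset_interior_closedBall (Metric.mem_ball_self (hr a (huT ha)).1)⟩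
  have : Countable u := hucount.to_subtype
  -- total mass of the selected balls
  have hS : ∑' a : u, volume (Metric.closedBall (a : EuclideanSpace ℝ (Fin d)) (r a)) ≤
      ENNReal.ofReal (M * (2 ^ d * (R ^ d * V)) / t) := by
    rw [ENNReal.ofReal_div_of_pos htpos,
      ENNReal.le_div_iff_mul_le (Or.inl (by simpa using htpos)) (Or.inl ENNReal.ofReal_ne_top),
      ← ENNReal.tsum_mul_right]
    calc ∑' a : u, volume (Metric.closedBall (a : EuclideanSpace ℝ (Fin d)) (r a)) *
          ENNReal.ofReal t
        ≤ ∑' a : u, ∫⁻ y in Metric.closedBall (a : EuclideanSpace ℝ (Fin d)) (r a),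
            ENNReal.ofReal |f y - c0| := by
          refine ENNReal.tsum_le_tsum fun a => ?_
          rw [← ofReal_integral_eq_lintegral_ofReal (hgi _ (hfin _ _))
            (Filter.Eventually.of_forall fun y => abs_nonneg _)]
          refine le_trans ?_ (ENNReal.ofReal_le_ofReal (hr a (huT a.2)).2.2.1)
          rw [ENNReal.ofReal_mul htpos.le, mul_comm, ofReal_measureReal (hfin _ _)]
      _ = ∫⁻ y in ⋃ a ∈ u, Metric.closedBall a (r a), ENNReal.ofReal |f y - c0| :=
          (lintegral_biUnion hucount (fun a _ => Metric.isClosed_closedBall.measurableSet)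
            hdisj _).symm
      _ ≤ ∫⁻ y in Metric.closedBall x0 (2 * R), ENNReal.ofReal |f y - c0| := by
          apply lintegral_mono_set
          refine Set.iUnion₂_subset fun a ha => ?_
          apply Metric.closedBall_subset_closedBall'
          have h3 := huT ha
          have h4 := (hr a h3).2.1
          rw [hT] at h3
          have h5 := h3.1
          rw [Metric.mem_closedBall] at h5
          linarith
      _ ≤ ENNReal.ofReal (M * (2 ^ d * (R ^ d * V))) := by
          rw [← ofReal_integral_eq_lintegral_ofReal (hgi _ (hfin _ _))
            (Filter.Eventually.of_forall fun y => abs_nonneg _)]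
          apply ENNReal.ofReal_le_ofReal
          rw [hvol _ _ (by positivity), mul_pow, mul_assoc] at hc0
          exact hc0
  have hUm : MeasurableSet (⋃ a : u, Metric.closedBall (a : EuclideanSpace ℝ (Fin d)) (5 * r a)) :=
    MeasurableSet.iUnion fun a => Metric.isClosed_closedBall.measurableSet
  have hmain : ∫⁻ y in Metric.closedBall x0 R, ENNReal.ofReal ((f y - c0) ^ 2) ≤
      ENNReal.ofReal (t ^ 2) * volume (Metric.closedBall x0 R) +
      ENNReal.ofReal ((Φ + t ^ 2) * 5 ^ d) * ENNReal.ofReal (M * (2 ^ d * (R ^ d * V)) / t) := by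
    calc ∫⁻ y in Metric.closedBall x0 R, ENNReal.ofReal ((f y - c0) ^ 2)
        ≤ ∫⁻ y in Metric.closedBall x0 R, (ENNReal.ofReal (t ^ 2) +
            (⋃ a : u, Metric.closedBall (a : EuclideanSpace ℝ (Fin d)) (5 * r a)).indicator
              (fun y => ENNReal.ofReal ((f y - c0) ^ 2)) y) := by
          apply lintegral_mono_ae
          rw [ae_restrict_iff' Metric.isClosed_closedBall.measurableSet]
          filter_upwards [hsel] with y hy hyB
          by_cases hyt : t < |f y - c0|
          · have hyT : y ∈ T := by rw [hT]; exact ⟨hyB, hy hyB hyt⟩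
            obtain ⟨b, hb, hsub⟩ := hcov y hyT
            have hmem : y ∈ ⋃ a : u, Metric.closedBall
                (a : EuclideanSpace ℝ (Fin d)) (5 * r a) :=
              Set.mem_iUnion.2 ⟨⟨b, hb⟩, hsub (Metric.mem_closedBall_self (hr y hyT).1.le)⟩
            rw [Set.indicator_of_mem hmem]
            exact le_add_self
          · refine le_trans ?_ le_self_add
            apply ENNReal.ofReal_le_ofReal
            rw [← sq_abs]
            exact pow_le_pow_left₀ (abs_nonneg _) (not_lt.mp hyt) 2
      _ = ENNReal.ofReal (t ^ 2) * volume (Metric.closedBall x0 R) +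
            ∫⁻ y in Metric.closedBall x0 R,
            (⋃ a : u, Metric.closedBall (a : EuclideanSpace ℝ (Fin d)) (5 * r a)).indicator
              (fun y => ENNReal.ofReal ((f y - c0) ^ 2)) y := by
          rw [lintegral_add_left measurable_const, setLIntegral_const]
      _ ≤ ENNReal.ofReal (t ^ 2) * volume (Metric.closedBall x0 R) +
            ∫⁻ y in (⋃ a : u, Metric.closedBall (a : EuclideanSpace ℝ (Fin d)) (5 * r a)),
              ENNReal.ofReal ((f y - c0) ^ 2) := by
          refine add_le_add le_rfl ?_
          rw [← lintegral_indicator hUm]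
          exact setLIntegral_le_lintegral _ _
      _ ≤ ENNReal.ofReal (t ^ 2) * volume (Metric.closedBall x0 R) +
            ∑' a : u, ∫⁻ y in Metric.closedBall (a : EuclideanSpace ℝ (Fin d)) (5 * r a),
              ENNReal.ofReal ((f y - c0) ^ 2) := by
          gcongr
          exact lintegral_iUnion_le _ _
      _ ≤ ENNReal.ofReal (t ^ 2) * volume (Metric.closedBall x0 R) +
            ∑' a : u, ENNReal.ofReal ((Φ + t ^ 2) * 5 ^ d) *
              volume (Metric.closedBall (a : EuclideanSpace ℝ (Fin d)) (r a)) := by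
          gcongr with a
          have hra := hr a (huT a.2)
          have h5 : 0 < 5 * r a := by linarith [hra.1]
          obtain ⟨c1, hc1⟩ := h2 a (5 * r a) h5
          have := bmo_swap (hfin _ _) f c0 c1 Φ t (hfm _ (hfin _ _)) (hfm2 _ (hfin _ _)) hc1
            hra.2.2.2
          rw [← ofReal_integral_eq_lintegral_ofReal (hHi _ (hfin _ _))
            (Filter.Eventually.of_forall fun y => sq_nonneg _),
            ← ofReal_measureReal (hfin _ _), ← ENNReal.ofReal_mul (by positivity)]
          apply ENNReal.ofReal_le_ofReal
          refine this.trans (le_of_eq ?_)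
          rw [hvol _ _ h5, hvol _ _ hra.1, mul_pow]
          ring
      _ ≤ _ := by
          rw [ENNReal.tsum_mul_left]
          gcongr
  rw [← ofReal_integral_eq_lintegral_ofReal (hHi _ (hfin _ _))
    (Filter.Eventually.of_forall fun y => sq_nonneg _), ← ofReal_measureReal (hfin _ _),
    ← ENNReal.ofReal_mul (by positivity), ← ENNReal.ofReal_mul (by positivity),
    ← ENNReal.ofReal_add (by positivity) (by positivity),
    ENNReal.ofReal_le_ofReal_iff (by positivity)] at hmain
  refine hmain.trans (le_of_eq ?_)
  rw [hvol _ _ hR, ht]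
  have h10 : (10 : ℝ) ^ d = 2 ^ d * 5 ^ d := by rw [← mul_pow]; norm_num
  rw [h10]
  field_simp
  ring

theorem bmo_bdd {d : ℕ} (f : EuclideanSpace ℝ (Fin d) → ℝ)
    (hf : AEStronglyMeasurable f volume) (N : ℝ) (hN : ∀ y, |f y| ≤ N)
    (M : ℝ) (hM : 0 < M)
    (h1 : ∀ (x : EuclideanSpace ℝ (Fin d)) (r : ℝ), 0 < r → ∃ c : ℝ,
      ∫ y in Metric.closedBall x r, |f y - c| ≤ M * volume.real (Metric.closedBall x r)) :
    ∀ (x : EuclideanSpace ℝ (Fin d)) (r : ℝ), 0 < r → ∃ c : ℝ,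
      ∫ y in Metric.closedBall x r, (f y - c) ^ 2 ≤
        (13 * (10 ^ d) ^ 2 * M ^ 2) * volume.real (Metric.closedBall x r) := by
  have hiter : ∀ n : ℕ, ∀ (x : EuclideanSpace ℝ (Fin d)) (r : ℝ), 0 < r → ∃ c : ℝ,
      ∫ y in Metric.closedBall x r, (f y - c) ^ 2 ≤
        (12 * (10 ^ d) ^ 2 * M ^ 2 + N ^ 2 * (1 / 2) ^ n) *
          volume.real (Metric.closedBall x r) := by
    intro n
    induction n with
    | zero =>
      intro x r hr
      refine ⟨0, ?_⟩
      have hb : ∀ y, ‖(f y - 0) ^ 2‖ ≤ N ^ 2 := fun y => by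
        rw [sub_zero, Real.norm_eq_abs, abs_pow]
        exact pow_le_pow_left₀ (abs_nonneg _) (hN y) 2
      have := norm_setIntegral_le_of_norm_le_const (μ := volume) (s := Metric.closedBall x r)
        (f := fun y => (f y - 0) ^ 2) measure_closedBall_lt_top (fun y _ => hb y)
      refine (le_abs_self _).trans (this.trans ?_)
      apply mul_le_mul_of_nonneg_right _ measureReal_nonneg
      have : 0 ≤ 12 * ((10 : ℝ) ^ d) ^ 2 * M ^ 2 := by positivity
      simpa using this
    | succ n ih =>
      intro x r hr
      obtain ⟨c, hc⟩ := bmo_step f hf N hN M hM _ (by positivity) h1 ih x r hr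
      refine ⟨c, hc.trans (le_of_eq ?_)⟩
      rw [pow_succ]
      ring
  intro x r hr
  have hlim : Filter.Tendsto (fun n : ℕ => N ^ 2 * (1 / 2 : ℝ) ^ n) Filter.atTop (nhds 0) := by
    simpa using (tendsto_pow_atTop_nhds_zero_of_lt_one (r := (1 / 2 : ℝ))
      (by norm_num) (by norm_num)).const_mul (N ^ 2)
  have hpos : 0 < ((10 : ℝ) ^ d) ^ 2 * M ^ 2 := by positivity
  obtain ⟨n, hn⟩ := (hlim.eventually_lt_const hpos).exists
  obtain ⟨c, hc⟩ := hiter n x r hr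
  refine ⟨c, hc.trans (mul_le_mul_of_nonneg_right ?_ measureReal_nonneg)⟩
  linarith

theorem bmo_trunc_lip (n a b : ℝ) :
    |max (-n) (min n a) - max (-n) (min n b)| ≤ |a - b| := by
  refine (abs_max_sub_max_le_max _ _ _ _).trans ?_
  rw [sub_self, abs_zero, max_eq_right (abs_nonneg _)]
  refine (abs_min_sub_min_le_max _ _ _ _).trans ?_
  rw [sub_self, abs_zero, max_eq_right (abs_nonneg _)]

theorem bmo_trunc_tendsto (a : ℝ) :
    Filter.Tendsto (fun n : ℕ => max (-(n : ℝ)) (min (n : ℝ) a)) Filter.atTop (nhds a) := by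
  apply tendsto_const_nhds.congr'
  obtain ⟨m, hm⟩ := exists_nat_ge |a|
  filter_upwards [Filter.eventually_ge_atTop m] with n hn
  have hn' : (m : ℝ) ≤ n := by exact_mod_cast hn
  have h := abs_le.1 (hm.trans hn')
  rw [min_eq_right h.2, max_eq_right h.1]

/-- John–Nirenberg, in its `L²` form. -/
theorem bmo_L2 {d : ℕ} (f : EuclideanSpace ℝ (Fin d) → ℝ)
    (hf : LocallyIntegrable f volume) (hf2 : LocallyIntegrable (fun y => f y * f y) volume)
    (M : ℝ) (hM : 0 < M)
    (h1 : ∀ (x : EuclideanSpace ℝ (Fin d)) (r : ℝ), 0 < r → ∃ c : ℝ,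
      ∫ y in Metric.closedBall x r, |f y - c| ≤ M * volume.real (Metric.closedBall x r)) :
    ∀ (x : EuclideanSpace ℝ (Fin d)) (r : ℝ), 0 < r → ∃ c : ℝ,
      ∫ y in Metric.closedBall x r, (f y - c) ^ 2 ≤
        (14 * (10 ^ d) ^ 2 * M ^ 2) * volume.real (Metric.closedBall x r) := by
  have hfin : ∀ (x : EuclideanSpace ℝ (Fin d)) (r : ℝ),
      volume (Metric.closedBall x r) ≠ ⊤ := fun x r => measure_closedBall_lt_top.ne
  have hfi : ∀ (x : EuclideanSpace ℝ (Fin d)) (r : ℝ),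
      IntegrableOn f (Metric.closedBall x r) volume :=
    fun x r => hf.integrableOn_isCompact (isCompact_closedBall x r)
  have hTm : ∀ n : ℕ, AEStronglyMeasurable (fun y => max (-(n : ℝ)) (min (n : ℝ) (f y))) volume :=
    fun n => by
      have hc : Continuous fun a : ℝ => max (-(n : ℝ)) (min (n : ℝ) a) := by fun_prop
      exact hc.comp_aestronglyMeasurable hf.aestronglyMeasurable
  have hTb : ∀ (n : ℕ) y, |max (-(n : ℝ)) (min (n : ℝ) (f y))| ≤ n := fun n y => by
    have hn : (0 : ℝ) ≤ n := n.cast_nonneg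
    rw [abs_le]
    exact ⟨le_max_left _ _, max_le (by linarith) (min_le_left _ _)⟩
  have hT1 : ∀ (n : ℕ) (x : EuclideanSpace ℝ (Fin d)) (r : ℝ) (c : ℝ),
      ∫ y in Metric.closedBall x r, |f y - c| ≤ M * volume.real (Metric.closedBall x r) →
      ∫ y in Metric.closedBall x r, |max (-(n : ℝ)) (min (n : ℝ) (f y)) -
        max (-(n : ℝ)) (min (n : ℝ) c)| ≤ M * volume.real (Metric.closedBall x r) := by
    intro n x r c hc
    refine le_trans ?_ hc
    apply integral_mono_of_nonneg (Filter.Eventually.of_forall fun y => abs_nonneg _)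
      ((hfi x r).sub (integrableOn_const (hfin _ _))).abs
    exact Filter.Eventually.of_forall fun y => bmo_trunc_lip _ _ _
  intro x r hr
  obtain ⟨c, hc⟩ := h1 x r hr
  refine ⟨c, ?_⟩
  have hbound : ∀ n : ℕ, ∫ y in Metric.closedBall x r, (max (-(n : ℝ)) (min (n : ℝ) (f y)) -
        max (-(n : ℝ)) (min (n : ℝ) c)) ^ 2 ≤
        (14 * (10 ^ d) ^ 2 * M ^ 2) * volume.real (Metric.closedBall x r) := by
    intro n
    obtain ⟨c1, hc1⟩ := bmo_bdd _ (hTm n) n (hTb n) M hM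
      (fun x r hr => by
        obtain ⟨c, hc⟩ := h1 x r hr
        exact ⟨_, hT1 n x r c hc⟩) x r hr
    have hi : IntegrableOn (fun y => max (-(n : ℝ)) (min (n : ℝ) (f y)))
        (Metric.closedBall x r) volume :=
      Measure.integrableOn_of_bounded (hfin x r) (hTm n) (M := n)
        (Filter.Eventually.of_forall fun y => by simpa only [Real.norm_eq_abs] using hTb n y)
    have hi2 : IntegrableOn (fun y => max (-(n : ℝ)) (min (n : ℝ) (f y)) ^ 2)
        (Metric.closedBall x r) volume :=
      Measure.integrableOn_of_bounded (hfin x r) ((hTm n).pow 2) (M := (n : ℝ) ^ 2)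
        (Filter.Eventually.of_forall fun y => by
          rw [Real.norm_eq_abs, abs_pow]
          exact pow_le_pow_left₀ (abs_nonneg _) (hTb n y) 2)
    refine (bmo_swap (hfin x r) _ _ c1 _ M hi hi2 hc1 (hT1 n x r c hc)).trans ?_
    apply mul_le_mul_of_nonneg_right _ measureReal_nonneg
    have : (1 : ℝ) ≤ (10 ^ d) ^ 2 := one_le_pow₀ (one_le_pow₀ (by norm_num))
    nlinarith [sq_nonneg M]
  refine le_of_tendsto' (tendsto_integral_of_dominated_convergence
    (fun y => (f y - c) ^ 2) ?_ ?_ ?_ ?_) hbound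
  · intro n
    exact (((hTm n).sub aestronglyMeasurable_const).pow 2).restrict
  · have : (fun y => (f y - c) ^ 2) = fun y => f y * f y - 2 * c * f y + c ^ 2 := by
      ext y; ring
    rw [this]
    exact ((hf2.integrableOn_isCompact (isCompact_closedBall x r)).sub
      ((hfi x r).const_mul (2 * c))).add (integrableOn_const (hfin x r))
  · intro n
    refine Filter.Eventually.of_forall fun y => ?_
    rw [Real.norm_eq_abs, abs_pow, ← sq_abs (f y - c)]
    exact pow_le_pow_left₀ (abs_nonneg _) (bmo_trunc_lip _ _ _) 2
  · exact Filter.Eventually.of_forall fun y =>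
      ((bmo_trunc_tendsto (f y)).sub (bmo_trunc_tendsto c)).pow 2

theorem bmo_cov {α : Type*} [MeasurableSpace α] {μ : Measure α} (φ f g : α → ℝ)
    (hφ : ∀ y, 0 ≤ φ y) (h1 : ∫ y, φ y ∂μ = 1) (i0 : Integrable φ μ)
    (i1 : Integrable (fun y => φ y * f y) μ) (i2 : Integrable (fun y => φ y * g y) μ)
    (i11 : Integrable (fun y => φ y * (f y * f y)) μ)
    (i22 : Integrable (fun y => φ y * (g y * g y)) μ)
    (i12 : Integrable (fun y => φ y * (f y * g y)) μ) (a b Q : ℝ)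
    (ha : ∫ y, φ y * (f y - a) ^ 2 ∂μ ≤ Q) (hb : ∫ y, φ y * (g y - b) ^ 2 ∂μ ≤ Q) :
    |(∫ y, φ y * f y ∂μ) * (∫ y, φ y * g y ∂μ) - ∫ y, φ y * (f y * g y) ∂μ| ≤ Q := by
  have hexp : ∀ p q s : ℝ, ∫ y, φ y * (p * f y + q * g y + s) ^ 2 ∂μ =
      p ^ 2 * ∫ y, φ y * (f y * f y) ∂μ + q ^ 2 * ∫ y, φ y * (g y * g y) ∂μ
      + 2 * p * q * ∫ y, φ y * (f y * g y) ∂μ + 2 * p * s * ∫ y, φ y * f y ∂μ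
      + 2 * q * s * ∫ y, φ y * g y ∂μ + s ^ 2 := by
    intro p q s
    have e : (fun y => φ y * (p * f y + q * g y + s) ^ 2) = fun y =>
        p ^ 2 * (φ y * (f y * f y)) + q ^ 2 * (φ y * (g y * g y))
        + 2 * p * q * (φ y * (f y * g y)) + 2 * p * s * (φ y * f y)
        + 2 * q * s * (φ y * g y) + s ^ 2 * φ y := by
      ext y; ring
    have j1 := (i11.const_mul (p ^ 2)).fun_add (i22.const_mul (q ^ 2))
    have j2 := j1.fun_add (i12.const_mul (2 * p * q))
    have j3 := j2.fun_add (i1.const_mul (2 * p * s))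
    have j4 := j3.fun_add (i2.const_mul (2 * q * s))
    rw [e, integral_add j4 (i0.const_mul _), integral_add j3 (i2.const_mul _),
      integral_add j2 (i1.const_mul _), integral_add j1 (i12.const_mul _),
      integral_add (i11.const_mul _) (i22.const_mul _)]
    simp only [integral_const_mul, h1, mul_one]
  have hnn : ∀ p q s : ℝ, 0 ≤ ∫ y, φ y * (p * f y + q * g y + s) ^ 2 ∂μ := fun p q s =>
    integral_nonneg fun y => mul_nonneg (hφ y) (sq_nonneg _)
  have ea := hexp 1 0 (-a)
  have eb := hexp 0 1 (-b)
  simp only [one_mul, zero_mul, add_zero, zero_add, ← sub_eq_add_neg] at ea eb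
  rw [ea] at ha
  rw [eb] at hb
  generalize hm : ∫ y, φ y * f y ∂μ = m at *
  generalize hn : ∫ y, φ y * g y ∂μ = n at *
  have n1 := hnn 1 1 (-(m + n))
  have n2 := hnn 1 (-1) (-(m - n))
  rw [hexp] at n1 n2
  rw [abs_le]
  constructor <;> nlinarith [sq_nonneg (m - a), sq_nonneg (n - b)]

theorem bmo_moll {d : ℕ}
    (ρ : EuclideanSpace ℝ (Fin d) → ℝ) (hρc : Continuous ρ) (hρ0 : ∀ x, 0 ≤ ρ x)
    (hρsupp : Function.support ρ ⊆ Metric.ball 0 1) (hρint : ∫ x, ρ x = 1) :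
    ∃ C > 0, ∀ ℓ : ℝ, 0 < ℓ →
      ∀ v : EuclideanSpace ℝ (Fin d) → EuclideanSpace ℝ (Fin d),
      LocallyIntegrable v volume →
      (∀ i j : Fin d, LocallyIntegrable (fun y => v y i * v y j) volume) →
      ∀ M : ℝ, 0 < M →
      (∀ (x : EuclideanSpace ℝ (Fin d)) (r : ℝ), 0 < r →
        (⨍ y in Metric.ball x r, ‖v y - ⨍ z in Metric.ball x r, v z‖) ≤ M) →
      ∀ (x : EuclideanSpace ℝ (Fin d)) (i j : Fin d),
        |(∫ y, ℓ ^ (-(d : ℝ)) * ρ (ℓ⁻¹ • (x - y)) * v y i) *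
            (∫ y, ℓ ^ (-(d : ℝ)) * ρ (ℓ⁻¹ • (x - y)) * v y j) -
          ∫ y, ℓ ^ (-(d : ℝ)) * ρ (ℓ⁻¹ • (x - y)) * (v y i * v y j)|
          ≤ C * M ^ 2 := by
  have hcs : HasCompactSupport ρ := HasCompactSupport.intro (isCompact_closedBall 0 1)
    fun x hx => by
      by_contra h
      exact hx (Metric.ball_subset_closedBall (hρsupp h))
  obtain ⟨S, hS⟩ := hcs.exists_bound_of_continuous hρc
  have hS0 : 0 ≤ S := (norm_nonneg _).trans (hS 0)
  obtain ⟨V, hV, hvol, hvolb⟩ : ∃ V : ℝ, 0 < V ∧ (∀ (x : EuclideanSpace ℝ (Fin d)) (r : ℝ),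
      0 < r → volume.real (Metric.closedBall x r) = r ^ d * V) ∧
      (∀ (x : EuclideanSpace ℝ (Fin d)) (r : ℝ),
      0 < r → volume.real (Metric.ball x r) = r ^ d * V) := by
    refine ⟨volume.real (Metric.ball (0 : EuclideanSpace ℝ (Fin d)) 1), ?_, fun x r hr => ?_,
      fun x r hr => ?_⟩
    · exact ENNReal.toReal_pos (Metric.measure_ball_pos _ _ one_pos).ne' measure_ball_lt_top.ne
    · rw [Measure.addHaar_real_closedBall _ _ hr.le, finrank_euclideanSpace_fin]
    · rw [Measure.real, Measure.addHaar_ball_of_pos _ _ hr, finrank_euclideanSpace_fin,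
        ENNReal.toReal_mul, ENNReal.toReal_ofReal (by positivity), Measure.real]
  have hfin : ∀ (x : EuclideanSpace ℝ (Fin d)) (r : ℝ),
      volume (Metric.closedBall x r) ≠ ⊤ := fun x r => measure_closedBall_lt_top.ne
  refine ⟨S * (14 * (10 ^ d) ^ 2 * (2 ^ d) ^ 2 * V) + 1, by positivity, ?_⟩
  intro ℓ hℓ v hv hv2 M hM hbmo x i j
  have hvi : ∀ k : Fin d, LocallyIntegrable (fun y => v y k) volume := fun k => by
    rw [locallyIntegrable_iff] at hv ⊢
    intro K hK
    exact (EuclideanSpace.proj (𝕜 := ℝ) k).integrable_comp (hv K hK)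
  have h1 : ∀ (k : Fin d) (x : EuclideanSpace ℝ (Fin d)) (r : ℝ), 0 < r → ∃ c : ℝ,
      ∫ y in Metric.closedBall x r, |v y k - c| ≤
        (2 ^ d * M) * volume.real (Metric.closedBall x r) := by
    intro k x r hr
    have hb := hbmo x (2 * r) (by positivity)
    have hfb : volume (Metric.ball x (2 * r)) ≠ ⊤ := measure_ball_lt_top.ne
    generalize (⨍ z in Metric.ball x (2 * r), v z) = a at hb
    have hp : 0 < volume.real (Metric.ball x (2 * r)) := by
      rw [hvolb _ _ (by positivity)]; positivity
    rw [setAverage_eq, smul_eq_mul, inv_mul_eq_div, div_le_iff₀ hp,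
      hvolb _ _ (by positivity), mul_pow] at hb
    refine ⟨a k, ?_⟩
    have hint : IntegrableOn (fun y => ‖v y - a‖) (Metric.ball x (2 * r)) volume :=
      (((hv.integrableOn_isCompact (isCompact_closedBall x (2 * r))).mono_set
        Metric.ball_subset_closedBall).sub (integrableOn_const hfb)).norm
    have hsub : Metric.closedBall x r ⊆ Metric.ball x (2 * r) :=
      Metric.closedBall_subset_ball (by linarith)
    calc ∫ y in Metric.closedBall x r, |v y k - a k|
        ≤ ∫ y in Metric.closedBall x r, ‖v y - a‖ := by
          apply integral_mono_of_nonneg (Filter.Eventually.of_forall fun y => abs_nonneg _)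
            (hint.mono_set hsub)
          refine Filter.Eventually.of_forall fun y => ?_
          simpa using PiLp.norm_apply_le (v y - a) k
      _ ≤ ∫ y in Metric.ball x (2 * r), ‖v y - a‖ :=
          setIntegral_mono_set hint (Filter.Eventually.of_forall fun y => norm_nonneg _)
            (Filter.Eventually.of_forall hsub)
      _ ≤ _ := hb
      _ = _ := by rw [hvol _ _ hr]; ring
  have hφc : Continuous fun y => ℓ ^ (-(d : ℝ)) * ρ (ℓ⁻¹ • (x - y)) := by fun_prop
  have hφsupp : ∀ y, y ∉ Metric.closedBall x ℓ → ρ (ℓ⁻¹ • (x - y)) = 0 := by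
    intro y hy
    by_contra h
    apply hy
    have h3 := hρsupp h
    rw [mem_ball_zero_iff, norm_smul, norm_inv, Real.norm_of_nonneg hℓ.le, inv_mul_eq_div,
      div_lt_one hℓ] at h3
    rw [Metric.mem_closedBall, dist_comm, dist_eq_norm]
    exact h3.le
  have hφcs : HasCompactSupport fun y => ℓ ^ (-(d : ℝ)) * ρ (ℓ⁻¹ • (x - y)) :=
    HasCompactSupport.intro (isCompact_closedBall x ℓ) fun y hy => by
      rw [hφsupp y hy, mul_zero]
  have hℓd : ℓ ^ (-(d : ℝ)) * ℓ ^ d = 1 := by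
    rw [Real.rpow_neg hℓ.le, Real.rpow_natCast]
    exact inv_mul_cancel₀ (by positivity)
  have hℓpos : 0 < ℓ ^ (-(d : ℝ)) := Real.rpow_pos_of_pos hℓ _
  have hφ0 : ∀ y, 0 ≤ ℓ ^ (-(d : ℝ)) * ρ (ℓ⁻¹ • (x - y)) := fun y =>
    mul_nonneg hℓpos.le (hρ0 _)
  have hφ1 : ∫ y, ℓ ^ (-(d : ℝ)) * ρ (ℓ⁻¹ • (x - y)) = 1 := by
    rw [integral_const_mul, integral_sub_left_eq_self (fun z => ρ (ℓ⁻¹ • z)) volume x,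
      Measure.integral_comp_inv_smul, finrank_euclideanSpace_fin, hρint,
      abs_of_pos (by positivity), smul_eq_mul, mul_one, hℓd]
  have hI : ∀ w : EuclideanSpace ℝ (Fin d) → ℝ, LocallyIntegrable w volume →
      Integrable (fun y => ℓ ^ (-(d : ℝ)) * ρ (ℓ⁻¹ • (x - y)) * w y) volume := fun w hw =>
    hw.integrable_smul_left_of_hasCompactSupport hφc hφcs
  have hosc : ∀ k : Fin d, ∃ a : ℝ,
      ∫ y, ℓ ^ (-(d : ℝ)) * ρ (ℓ⁻¹ • (x - y)) * (v y k - a) ^ 2 ≤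
        (S * (14 * (10 ^ d) ^ 2 * (2 ^ d) ^ 2 * V) + 1) * M ^ 2 := by
    intro k
    obtain ⟨a, ha⟩ := bmo_L2 _ (hvi k) (hv2 k k) (2 ^ d * M) (by positivity) (h1 k) x ℓ hℓ
    refine ⟨a, ?_⟩
    have hsq : IntegrableOn (fun y => (v y k - a) ^ 2) (Metric.closedBall x ℓ) volume := by
      have : (fun y => (v y k - a) ^ 2) = fun y => v y k * v y k - 2 * a * v y k + a ^ 2 := by
        ext y; ring
      rw [this]
      exact (((hv2 k k).integrableOn_isCompact (isCompact_closedBall x ℓ)).sub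
        (((hvi k).integrableOn_isCompact (isCompact_closedBall x ℓ)).const_mul (2 * a))).add
        (integrableOn_const (hfin x ℓ))
    calc ∫ y, ℓ ^ (-(d : ℝ)) * ρ (ℓ⁻¹ • (x - y)) * (v y k - a) ^ 2
        = ∫ y in Metric.closedBall x ℓ,
            ℓ ^ (-(d : ℝ)) * ρ (ℓ⁻¹ • (x - y)) * (v y k - a) ^ 2 := by
          refine (setIntegral_eq_integral_of_forall_compl_eq_zero fun y hy => ?_).symm
          rw [hφsupp y hy, mul_zero, zero_mul]
      _ ≤ ∫ y in Metric.closedBall x ℓ, ℓ ^ (-(d : ℝ)) * S * (v y k - a) ^ 2 := by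
          apply integral_mono_of_nonneg (Filter.Eventually.of_forall fun y =>
            mul_nonneg (hφ0 y) (sq_nonneg _)) (hsq.const_mul _)
          refine Filter.Eventually.of_forall fun y => ?_
          have := (le_abs_self _).trans (hS (ℓ⁻¹ • (x - y)))
          simp only
          gcongr
      _ = ℓ ^ (-(d : ℝ)) * S * ∫ y in Metric.closedBall x ℓ, (v y k - a) ^ 2 :=
          integral_const_mul _ _
      _ ≤ ℓ ^ (-(d : ℝ)) * S * ((14 * (10 ^ d) ^ 2 * (2 ^ d * M) ^ 2) * (ℓ ^ d * V)) := by
          rw [← hvol x ℓ hℓ]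
          gcongr
      _ = (ℓ ^ (-(d : ℝ)) * ℓ ^ d) * (S * (14 * (10 ^ d) ^ 2 * (2 ^ d) ^ 2 * V) * M ^ 2) := by
          ring
      _ ≤ _ := by
          rw [hℓd]
          nlinarith [sq_nonneg M]
  obtain ⟨a, ha⟩ := hosc i
  obtain ⟨b, hb⟩ := hosc j
  exact bmo_cov _ (fun y => v y i) (fun y => v y j) hφ0 hφ1
    (hφc.integrable_of_hasCompactSupport hφcs) (hI _ (hvi i)) (hI _ (hvi j))
    (hI _ (hv2 i i)) (hI _ (hv2 j j)) (hI _ (hv2 i j)) a b _ ha hb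

/-- Mollification commutator estimate in BMO: there is `C > 0` (depending
only on the mollification kernel `ρ` and the dimension) such that for every scale `ℓ > 0`
and every `v ∈ BMO ∩ L²_loc`, `‖v_ℓ ⊗ v_ℓ − (v ⊗ v)_ℓ‖_{L^∞} ≤ C ‖v‖²_{BMO}`. -/
theorem stmt7 {d : ℕ}
    (ρ : EuclideanSpace ℝ (Fin d) → ℝ) (hρc : Continuous ρ) (hρ0 : ∀ x, 0 ≤ ρ x)
    (hρsupp : Function.support ρ ⊆ Metric.ball 0 1) (hρint : ∫ x, ρ x = 1) :
    ∃ C > 0, ∀ ℓ : ℝ, 0 < ℓ →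
      ∀ v : EuclideanSpace ℝ (Fin d) → EuclideanSpace ℝ (Fin d),
      LocallyIntegrable v volume →
      (∀ i j : Fin d, LocallyIntegrable (fun y => v y i * v y j) volume) →
      ∀ M : ℝ, 0 ≤ M →
      (∀ (x : EuclideanSpace ℝ (Fin d)) (r : ℝ), 0 < r →
        (⨍ y in Metric.ball x r, ‖v y - ⨍ z in Metric.ball x r, v z‖) ≤ M) →
      ∀ (x : EuclideanSpace ℝ (Fin d)) (i j : Fin d),
        |(∫ y, ℓ ^ (-(d : ℝ)) * ρ (ℓ⁻¹ • (x - y)) * v y i) *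
            (∫ y, ℓ ^ (-(d : ℝ)) * ρ (ℓ⁻¹ • (x - y)) * v y j) -
          ∫ y, ℓ ^ (-(d : ℝ)) * ρ (ℓ⁻¹ • (x - y)) * (v y i * v y j)|
          ≤ C * M ^ 2 := by
  obtain ⟨C, hC, h⟩ := bmo_moll ρ hρc hρ0 hρsupp hρint
  refine ⟨C, hC, ?_⟩
  intro ℓ hℓ v hv hv2 M hM hbmo x i j
  have hlim : Filter.Tendsto (fun m : ℝ => C * m ^ 2) (nhdsWithin M (Set.Ioi M))
      (nhds (C * M ^ 2)) := by
    have hc : Continuous fun m : ℝ => C * m ^ 2 := by fun_prop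
    exact (hc.tendsto M).mono_left nhdsWithin_le_nhds
  refine ge_of_tendsto hlim ?_
  filter_upwards [self_mem_nhdsWithin] with m hm
  have hm' : M < m := hm
  exact h ℓ hℓ v hv hv2 m (hM.trans_lt hm') (fun x r hr => (hbmo x r hr).trans hm'.le) x i j
end

section
/- There exists a constant C > 0 such that for all ℓ > 0, all v ∈ BMO(ℝ^d; ℝ^d) and all u ∈ BD(ℝ^d), the Constantin–E–Titi flux satisfies ‖(v_ℓ ⊗ v_ℓ − (v ⊗ v)_ℓ) : ∇u_ℓ‖_{L¹} ≤ C ‖v‖²_{BMO} ‖Eu‖_{ℳ}. -/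
open MeasureTheory
open scoped ContDiff

noncomputable section

variable {d : ℕ}

/-- The rescaled kernel `ρ_ℓ(x) = ℓ^{-d} ρ(x/ℓ)`. -/
def rescale (ρ : EuclideanSpace ℝ (Fin d) → ℝ) (ℓ : ℝ) (x : EuclideanSpace ℝ (Fin d)) : ℝ :=
  ℓ ^ (-(d : ℝ)) * ρ (ℓ⁻¹ • x)

/-- Mollification `f_ℓ = f * ρ_ℓ` of a (vector-valued) function at scale `ℓ`. -/
def moll {F : Type*} [NormedAddCommGroup F] [NormedSpace ℝ F] [CompleteSpace F]
    (ρ : EuclideanSpace ℝ (Fin d) → ℝ) (ℓ : ℝ)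
    (f : EuclideanSpace ℝ (Fin d) → F) (x : EuclideanSpace ℝ (Fin d)) : F :=
  ∫ y, rescale ρ ℓ (x - y) • f y

open Metric Filter Topology in
theorem aux_cover {h : EuclideanSpace ℝ (Fin d) → ℝ} (h0 : ∀ y, 0 ≤ h y)
    (hi : LocallyIntegrable h volume) (hi2 : LocallyIntegrable (fun y => h y ^ 2) volume)
    {x : EuclideanSpace ℝ (Fin d)} {r lam c : ℝ} (hr : 0 < r) (hl : 0 < lam) (hc : 0 ≤ c)
    (h1 : ∀ y ∈ closedBall x r, ∫ z in closedBall y r, h z ≤ lam * volume.real (closedBall y r))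
    (h2 : ∀ y ∈ closedBall x r, ∀ s, 0 < s → 4 * s ≤ r →
      ∫ z in closedBall y (4 * s), h z ≤ lam * volume.real (closedBall y (4 * s)) →
      lam * volume.real (closedBall y s) < ∫ z in closedBall y s, h z →
      ∫ z in closedBall y (4 * s), h z ^ 2 ≤ c * ∫ z in closedBall y s, h z) :
    ∫ z in closedBall x r, h z ^ 2 ≤
      lam ^ 2 * volume.real (closedBall x r) + c * ∫ z in closedBall x (2 * r), h z := by
  have hint : ∀ y s, IntegrableOn h (closedBall y s) volume := fun y s =>
    hi.integrableOn_isCompact (isCompact_closedBall y s)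
  have hint2 : ∀ y s, IntegrableOn (fun z => h z ^ 2) (closedBall y s) volume := fun y s =>
    hi2.integrableOn_isCompact (isCompact_closedBall y s)
  set T : Set (EuclideanSpace ℝ (Fin d)) := {y | y ∈ closedBall x r ∧ ∃ s, 0 < s ∧ 4 * s ≤ r ∧
      ∫ z in closedBall y (4 * s), h z ≤ lam * volume.real (closedBall y (4 * s)) ∧
      lam * volume.real (closedBall y s) < ∫ z in closedBall y s, h z} with hT
  have hT' : ∀ y : EuclideanSpace ℝ (Fin d), ∃ s, y ∈ T → (0 < s ∧ 4 * s ≤ r ∧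
      ∫ z in closedBall y (4 * s), h z ≤ lam * volume.real (closedBall y (4 * s)) ∧
      lam * volume.real (closedBall y s) < ∫ z in closedBall y s, h z) := by
    intro y
    by_cases hy : y ∈ T
    · obtain ⟨s, hs⟩ := hy.2
      exact ⟨s, fun _ => hs⟩
    · exact ⟨0, fun h => absurd h hy⟩
  choose s hs using hT'
  obtain ⟨u, huT, hud, huc⟩ := Vitali.exists_disjoint_subfamily_covering_enlargement_closedBall
    T (fun y => y) s r (fun a ha => by linarith [(hs a ha).1, (hs a ha).2.1]) 4 (by norm_num)
  have hcount : u.Countable := hud.countable_of_nonempty_interior (fun i hi => by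
    refine ⟨i, ?_⟩
    exact ball_subset_interior_closedBall (mem_ball_self (hs i (huT hi)).1))
  set U := ⋃ b ∈ u, closedBall b (4 * s b) with hU
  have hUm : MeasurableSet U := MeasurableSet.biUnion hcount (fun _ _ => measurableSet_closedBall)
  -- a.e. points outside U have h ≤ lam
  have hae : ∀ᵐ y ∂(volume : Measure (EuclideanSpace ℝ (Fin d))),
      y ∈ closedBall x r \ U → h y ≤ lam := by
    filter_upwards [IsUnifLocDoublingMeasure.ae_tendsto_average (μ := volume) hi 1] with y hy hyU
    by_contra! hlt
    have ht : Tendsto (fun k : ℕ => r / 4 ^ k) atTop (𝓝[>] 0) := by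
      refine tendsto_nhdsWithin_iff.2 ⟨?_, Eventually.of_forall fun k => ?_⟩
      · have := (tendsto_pow_atTop_nhds_zero_of_lt_one (r := (1/4:ℝ)) (by norm_num) (by norm_num)).const_mul r
        simpa [div_eq_mul_inv] using this
      · simp only [Set.mem_Ioi]; positivity
    have h3 := hy (fun _ : ℕ => y) _ ht (Eventually.of_forall fun k => by
      apply mem_closedBall_self; positivity)
    have h4 : ∃ k : ℕ, lam * volume.real (closedBall y (r / 4 ^ k))
        < ∫ z in closedBall y (r / 4 ^ k), h z := by
      obtain ⟨k, hk⟩ := (h3.eventually (lt_mem_nhds hlt)).exists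
      refine ⟨k, ?_⟩
      rw [setAverage_eq, smul_eq_mul] at hk
      have hpos : 0 < volume.real (closedBall y (r / 4 ^ k)) :=
        ENNReal.toReal_pos (measure_closedBall_pos _ _ (by positivity)).ne'
          measure_closedBall_lt_top.ne
      rwa [inv_mul_eq_div, lt_div_iff₀ hpos] at hk
    classical
    have hk := Nat.find_spec h4
    have hmin := fun m => Nat.find_min (m := m) h4
    generalize Nat.find h4 = k at hk hmin
    rcases k with _ | k
    · simp only [pow_zero, div_one] at hk
      exact absurd (h1 y hyU.1) (not_le.2 hk)
    · have e : 4 * (r / 4 ^ (k+1)) = r / 4 ^ k := by field_simp; ring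
      have hyT : y ∈ T := by
        refine ⟨hyU.1, r / 4 ^ (k+1), by positivity, ?_, ?_, hk⟩
        · rw [e]; exact div_le_self hr.le (one_le_pow₀ (by norm_num))
        · rw [e]; exact not_lt.1 (hmin k (by omega))
      obtain ⟨b, hb, hsub⟩ := huc y hyT
      apply hyU.2
      exact Set.mem_biUnion hb (hsub (mem_closedBall_self (hs y hyT).1.le))
  have hnn : ∀ A : Set (EuclideanSpace ℝ (Fin d)), 0 ≤ ∫ z in A, h z := fun A =>
    integral_nonneg h0
  have key : ENNReal.ofReal (∫ z in closedBall x r, h z ^ 2) ≤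
      ENNReal.ofReal (lam ^ 2 * volume.real (closedBall x r) +
        c * ∫ z in closedBall x (2 * r), h z) := by
    rw [ofReal_integral_eq_lintegral_ofReal (hint2 _ _) (Eventually.of_forall fun z => sq_nonneg _),
      ENNReal.ofReal_add (by positivity) (mul_nonneg hc (hnn _)),
      ← lintegral_inter_add_sdiff _ _ hUm, add_comm]
    gcongr
    · calc ∫⁻ z in closedBall x r \ U, ENNReal.ofReal (h z ^ 2)
          ≤ ∫⁻ z in closedBall x r \ U, ENNReal.ofReal (lam ^ 2) := by
            apply lintegral_mono_ae
            filter_upwards [ae_restrict_of_ae hae, ae_restrict_mem (measurableSet_closedBall.diff hUm)] with z hz hz'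
            exact ENNReal.ofReal_le_ofReal (pow_le_pow_left₀ (h0 z) (hz hz') 2)
        _ ≤ ∫⁻ z in closedBall x r, ENNReal.ofReal (lam ^ 2) :=
            lintegral_mono_set Set.sdiff_subset
        _ = _ := by
            rw [lintegral_const, Measure.restrict_apply_univ, ENNReal.ofReal_mul (by positivity),
              ofReal_measureReal measure_closedBall_lt_top.ne]
    · calc ∫⁻ z in closedBall x r ∩ U, ENNReal.ofReal (h z ^ 2)
          ≤ ∫⁻ z in U, ENNReal.ofReal (h z ^ 2) := lintegral_mono_set Set.inter_subset_right
        _ ≤ ∑' b : u, ∫⁻ z in closedBall (b : EuclideanSpace ℝ (Fin d)) (4 * s b), ENNReal.ofReal (h z ^ 2) := by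
            have := hcount.to_subtype
            rw [hU, Set.biUnion_eq_iUnion]
            exact lintegral_iUnion_le _ _
        _ ≤ ∑' b : u, ENNReal.ofReal c * ∫⁻ z in closedBall (b : EuclideanSpace ℝ (Fin d)) (s b), ENNReal.ofReal (h z) := by
            refine ENNReal.tsum_le_tsum fun b => ?_
            have hb := hs b (huT b.2)
            rw [← ofReal_integral_eq_lintegral_ofReal (hint2 _ _) (Eventually.of_forall fun z => sq_nonneg _),
              ← ofReal_integral_eq_lintegral_ofReal (hint _ _) (Eventually.of_forall h0),
              ← ENNReal.ofReal_mul hc]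
            exact ENNReal.ofReal_le_ofReal (h2 b (huT b.2).1 _ hb.1 hb.2.1 hb.2.2.1 hb.2.2.2)
        _ = ENNReal.ofReal c * ∫⁻ z in ⋃ b ∈ u, closedBall b (s b), ENNReal.ofReal (h z) := by
            rw [ENNReal.tsum_mul_left, lintegral_biUnion hcount (fun _ _ => measurableSet_closedBall) hud]
        _ ≤ ENNReal.ofReal c * ∫⁻ z in closedBall x (2 * r), ENNReal.ofReal (h z) := by
            gcongr
            refine Set.iUnion₂_subset fun b hb => ?_
            have hb' := hs b (huT hb)
            refine closedBall_subset_closedBall' ?_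
            have := mem_closedBall.1 (huT hb).1
            linarith [hb'.1, hb'.2.1]
        _ = _ := by
            rw [ENNReal.ofReal_mul hc, ofReal_integral_eq_lintegral_ofReal (hint _ _) (Eventually.of_forall h0)]
  exact (ENNReal.ofReal_le_ofReal_iff (by have := hnn (closedBall x (2*r)); positivity)).1 key

theorem aux_vol (y y' : EuclideanSpace ℝ (Fin d)) {t s : ℝ} (ht : 0 < t) (hs : 0 < s) :
    volume.real (Metric.closedBall y (t * s)) = t ^ d * volume.real (Metric.closedBall y' s) := by
  rw [Measure.addHaar_real_closedBall' _ y (by positivity),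
    Measure.addHaar_real_closedBall' _ y' (by positivity)]
  simp [mul_pow, mul_assoc]

theorem aux_vol_pos (y : EuclideanSpace ℝ (Fin d)) {s : ℝ} (hs : 0 < s) :
    0 < volume.real (Metric.closedBall y s) :=
  ENNReal.toReal_pos (Metric.measure_closedBall_pos _ _ hs).ne' measure_closedBall_lt_top.ne

theorem aux_avg {f : EuclideanSpace ℝ (Fin d) → ℝ} {y : EuclideanSpace ℝ (Fin d)} {s : ℝ}
    (hs : 0 < s) (hf : IntegrableOn f (Metric.closedBall y s) volume) (a : ℝ) :
    |(⨍ z in Metric.closedBall y s, f z) - a| * volume.real (Metric.closedBall y s)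
      ≤ ∫ z in Metric.closedBall y s, |f z - a| := by
  have hV := aux_vol_pos y hs
  have hcst : IntegrableOn (fun _ => a) (Metric.closedBall y s) volume :=
    integrableOn_const measure_closedBall_lt_top.ne
  have e : ((⨍ z in Metric.closedBall y s, f z) - a) * volume.real (Metric.closedBall y s)
      = ∫ z in Metric.closedBall y s, (f z - a) := by
    rw [integral_sub hf hcst, setAverage_eq, setIntegral_const, smul_eq_mul, smul_eq_mul]
    field_simp
  have e2 := congrArg abs e
  rw [abs_mul, abs_of_pos hV] at e2
  rw [e2]
  exact abs_integral_le_integral_abs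

theorem aux_step {f : EuclideanSpace ℝ (Fin d) → ℝ} {N M K lam : ℝ}
    (hfm : AEStronglyMeasurable f volume) (hfN : ∀ y, |f y| ≤ N) (hM : 0 < M) (hK : 0 ≤ K)
    (hlam : lam = 4 * 4 ^ d * (2 * 4 ^ d) * M)
    (hbmo : ∀ y s, 0 < s → ∫ z in Metric.closedBall y s, |f z - ⨍ w in Metric.closedBall y s, f w|
      ≤ M * volume.real (Metric.closedBall y s))
    (hbK : ∀ y s, 0 < s → ∫ z in Metric.closedBall y s, (f z - ⨍ w in Metric.closedBall y s, f w) ^ 2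
      ≤ K * volume.real (Metric.closedBall y s)) :
    ∀ y s, 0 < s → ∫ z in Metric.closedBall y s, (f z - ⨍ w in Metric.closedBall y s, f w) ^ 2
      ≤ (K / 2 + 3 / 2 * lam ^ 2) * volume.real (Metric.closedBall y s) := by
  intro x r hr
  have hfl : LocallyIntegrable f volume := by
    refine (memLp_top_of_bound hfm N (Filter.Eventually.of_forall hfN)).locallyIntegrable le_top
  have hsm : ∀ a : ℝ, AEStronglyMeasurable (fun z => f z - a) volume := fun a =>
    hfm.sub aestronglyMeasurable_const
  have hbd : ∀ a z, |f z - a| ≤ N + |a| := fun a z => (abs_sub _ _).trans (by linarith [hfN z])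
  have hl1 : ∀ a : ℝ, LocallyIntegrable (fun z => |f z - a|) volume := fun a =>
    (memLp_top_of_bound (hsm a).norm (N + |a|) (Filter.Eventually.of_forall fun z => by
      simpa using hbd a z)).locallyIntegrable le_top
  have hl2 : ∀ a : ℝ, LocallyIntegrable (fun z => (f z - a) ^ 2) volume := fun a =>
    (memLp_top_of_bound ((hsm a).pow 2) ((N + |a|) ^ 2) (Filter.Eventually.of_forall fun z => by
      simpa using pow_le_pow_left₀ (abs_nonneg _) (hbd a z) 2)).locallyIntegrable le_top
  have hI : ∀ {g : EuclideanSpace ℝ (Fin d) → ℝ}, LocallyIntegrable g volume → ∀ y s,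
      IntegrableOn g (Metric.closedBall y s) volume := fun hg y s =>
    hg.integrableOn_isCompact (isCompact_closedBall y s)
  set a := ⨍ w in Metric.closedBall x r, f w with ha
  have hP : (1:ℝ) ≤ 4 ^ d := one_le_pow₀ (by norm_num)
  have hl : 0 < lam := by rw [hlam]; positivity
  have hVr := aux_vol_pos x hr
  -- bound on the double ball
  have h2B : ∫ z in Metric.closedBall x (2 * r), |f z - a|
      ≤ 2 * 4 ^ d * M * volume.real (Metric.closedBall x r) := by
    set b := ⨍ w in Metric.closedBall x (2 * r), f w with hb
    have hV2 := aux_vol x x (t := 2) (by norm_num) hr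
    have h3 := hbmo x (2 * r) (by positivity)
    rw [← hb, hV2] at h3
    have h4 : |a - b| * volume.real (Metric.closedBall x r)
        ≤ ∫ z in Metric.closedBall x (2 * r), |f z - b| :=
      (aux_avg hr (hI hfl _ _) b).trans (setIntegral_mono_set (hI (hl1 b) _ _)
        (Filter.Eventually.of_forall fun z => abs_nonneg _)
        (Metric.closedBall_subset_closedBall (by linarith)).eventuallyLE)
    have h5 : |a - b| ≤ M * 2 ^ d := by
      have := h4.trans h3
      rw [← mul_assoc] at this
      exact le_of_mul_le_mul_right this hVr
    have hcst : IntegrableOn (fun _ => |a - b|) (Metric.closedBall x (2 * r)) volume :=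
      integrableOn_const measure_closedBall_lt_top.ne
    have h6 : ∫ z in Metric.closedBall x (2 * r), |f z - a| ≤
        ∫ z in Metric.closedBall x (2 * r), (|f z - b| + |a - b|) := by
      refine integral_mono (hI (hl1 a) _ _) ((hI (hl1 b) _ _).add hcst) fun z => ?_
      have := abs_sub_le (f z) b a
      rw [abs_sub_comm b a] at this
      exact this
    rw [integral_add (hI (hl1 b) _ _) hcst, setIntegral_const, smul_eq_mul, hV2] at h6
    have h22 : (4:ℝ) ^ d = 2 ^ d * 2 ^ d := by rw [← mul_pow]; norm_num
    have h21 : (1:ℝ) ≤ 2 ^ d := one_le_pow₀ (by norm_num)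
    rw [h22]
    set V := volume.real (Metric.closedBall x r)
    calc _ ≤ _ := h6
      _ ≤ M * (2 ^ d * V) + 2 ^ d * V * (M * 2 ^ d) := by gcongr
      _ ≤ M * (2 ^ d * V) * 2 ^ d + 2 ^ d * V * (M * 2 ^ d) := by
        exact add_le_add_left (le_mul_of_one_le_right (by positivity) h21) _
      _ = _ := by ring
  have hcov := aux_cover (h := fun z => |f z - a|) (x := x) (r := r) (lam := lam)
    (c := 2 * (K + lam ^ 2) * 4 ^ d / lam) (fun z => abs_nonneg _) (hl1 a)
    (by simpa only [sq_abs] using hl2 a) hr hl (by positivity) ?_ ?_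
  · simp only [sq_abs] at hcov
    refine hcov.trans ?_
    have : 2 * (K + lam ^ 2) * 4 ^ d / lam * ∫ z in Metric.closedBall x (2 * r), |f z - a| ≤
        2 * (K + lam ^ 2) * 4 ^ d / lam * (2 * 4 ^ d * M * volume.real (Metric.closedBall x r)) := by
      gcongr
    have e : 2 * (K + lam ^ 2) * 4 ^ d / lam * (2 * 4 ^ d * M * volume.real (Metric.closedBall x r))
        = (K + lam ^ 2) / 2 * volume.real (Metric.closedBall x r) := by
      rw [div_mul_eq_mul_div, div_eq_iff hl.ne']
      nth_rewrite 3 [hlam]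
      ring
    linarith
  · intro y hy
    calc ∫ z in Metric.closedBall y r, |f z - a| ≤ ∫ z in Metric.closedBall x (2 * r), |f z - a| :=
          setIntegral_mono_set (hI (hl1 a) _ _)
            (Filter.Eventually.of_forall fun z => abs_nonneg _)
            (Metric.closedBall_subset_closedBall' (by
              have := Metric.mem_closedBall.1 hy; linarith)).eventuallyLE
      _ ≤ _ := h2B
      _ ≤ _ := by
        have e := aux_vol y x (t := 1) one_pos hr
        rw [one_mul, one_pow, one_mul] at e
        rw [e, hlam]
        refine mul_le_mul_of_nonneg_right (mul_le_mul_of_nonneg_right ?_ hM.le) hVr.le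
        nlinarith
  · intro y hy s hs hsr h3 h4
    simp only [sq_abs]
    set b := ⨍ w in Metric.closedBall y (4 * s), f w with hb
    have hs4 : 0 < 4 * s := by positivity
    have hV4 := aux_vol y y (t := 4) (by norm_num) hs
    have hba : |b - a| ≤ lam :=
      le_of_mul_le_mul_right ((aux_avg hs4 (hI hfl _ _) a).trans h3) (aux_vol_pos y hs4)
    have hcst : IntegrableOn (fun _ => 2 * lam ^ 2) (Metric.closedBall y (4 * s)) volume :=
      integrableOn_const measure_closedBall_lt_top.ne
    have h6 : ∫ z in Metric.closedBall y (4 * s), (f z - a) ^ 2 ≤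
        ∫ z in Metric.closedBall y (4 * s), (2 * (f z - b) ^ 2 + 2 * lam ^ 2) := by
      refine integral_mono (hI (hl2 a) _ _) (((hI (hl2 b) _ _).const_mul 2).add hcst) fun z => ?_
      have h7 : (b - a) ^ 2 ≤ lam ^ 2 := sq_le_sq.2 (by rwa [abs_of_pos hl])
      show (f z - a) ^ 2 ≤ 2 * (f z - b) ^ 2 + 2 * lam ^ 2
      nlinarith [sq_nonneg (f z - b - (b - a))]
    rw [integral_add ((hI (hl2 b) _ _).const_mul 2) hcst, setIntegral_const, smul_eq_mul, hV4,
      integral_const_mul] at h6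
    have h8 := hbK y (4 * s) hs4
    rw [← hb, hV4] at h8
    rw [div_mul_eq_mul_div, le_div_iff₀ hl]
    have h9 : 2 * (K + lam ^ 2) * 4 ^ d * (lam * volume.real (Metric.closedBall y s)) ≤
        2 * (K + lam ^ 2) * 4 ^ d * ∫ z in Metric.closedBall y s, |f z - a| := by gcongr
    refine le_trans ?_ h9
    have : ∫ z in Metric.closedBall y (4 * s), (f z - a) ^ 2 ≤
      2 * (K + lam ^ 2) * 4 ^ d * volume.real (Metric.closedBall y s) := by linarith
    nlinarith

theorem aux_jn_bdd {f : EuclideanSpace ℝ (Fin d) → ℝ} {N M : ℝ}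
    (hfm : AEStronglyMeasurable f volume) (hfN : ∀ y, |f y| ≤ N) (hM : 0 < M)
    (hbmo : ∀ y s, 0 < s → ∫ z in Metric.closedBall y s, |f z - ⨍ w in Metric.closedBall y s, f w|
      ≤ M * volume.real (Metric.closedBall y s)) :
    ∀ y s, 0 < s → ∫ z in Metric.closedBall y s, (f z - ⨍ w in Metric.closedBall y s, f w) ^ 2
      ≤ 3 * (4 * 4 ^ d * (2 * 4 ^ d) * M) ^ 2 * volume.real (Metric.closedBall y s) := by
  have hN : 0 ≤ N := (abs_nonneg _).trans (hfN 0)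
  have main : ∀ n : ℕ, ∀ y s, 0 < s →
      ∫ z in Metric.closedBall y s, (f z - ⨍ w in Metric.closedBall y s, f w) ^ 2
      ≤ (4 * N ^ 2 / 2 ^ n + 3 * (4 * 4 ^ d * (2 * 4 ^ d) * M) ^ 2) *
        volume.real (Metric.closedBall y s) := by
    intro n
    induction n with
    | zero =>
      intro y s hs
      have hV := aux_vol_pos y hs
      set b := ⨍ w in Metric.closedBall y s, f w with hb
      have hbN : |b| ≤ N := by
        have h1 : ‖∫ z in Metric.closedBall y s, f z‖ ≤ N * volume.real (Metric.closedBall y s) :=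
          norm_setIntegral_le_of_norm_le_const measure_closedBall_lt_top (fun z _ => hfN z)
        rw [hb, setAverage_eq, smul_eq_mul, abs_mul, abs_inv, abs_of_pos hV, inv_mul_le_iff₀ hV]
        rw [mul_comm]
        exact h1
      have h2 : ‖∫ z in Metric.closedBall y s, (f z - b) ^ 2‖ ≤
          4 * N ^ 2 * volume.real (Metric.closedBall y s) := by
        refine norm_setIntegral_le_of_norm_le_const measure_closedBall_lt_top (fun z _ => ?_)
        rw [Real.norm_eq_abs, abs_pow]
        have : |f z - b| ≤ 2 * N := (abs_sub _ _).trans (by linarith [hfN z])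
        nlinarith [abs_nonneg (f z - b)]
      refine (le_abs_self _).trans (h2.trans ?_)
      gcongr
      simp
      positivity
    | succ n ih =>
      intro y s hs
      have := aux_step (K := 4 * N ^ 2 / 2 ^ n + 3 * (4 * 4 ^ d * (2 * 4 ^ d) * M) ^ 2) hfm hfN hM
        (by positivity) rfl hbmo ih y s hs
      refine this.trans (le_of_eq ?_)
      congr 1
      field_simp
      ring
  intro y s hs
  refine ge_of_tendsto' (x := Filter.atTop) ?_ (fun n => main n y s hs)
  have h1 : Filter.Tendsto (fun n : ℕ => 4 * N ^ 2 / 2 ^ n) Filter.atTop (nhds 0) := by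
    have := (tendsto_pow_atTop_nhds_zero_of_lt_one (r := (1/2:ℝ)) (by norm_num)
      (by norm_num)).const_mul (4 * N ^ 2)
    simpa [div_eq_mul_inv] using this
  have h2 := (h1.add_const (3 * (4 * 4 ^ d * (2 * 4 ^ d) * M) ^ 2)).mul_const
    (volume.real (Metric.closedBall y s))
  simpa using h2


theorem aux_jn {f : EuclideanSpace ℝ (Fin d) → ℝ} {M : ℝ}
    (hf : LocallyIntegrable f volume) (hf2 : LocallyIntegrable (fun z => f z ^ 2) volume)
    (hM : 0 < M)
    (hbmo : ∀ y s, 0 < s → ∫ z in Metric.closedBall y s, |f z - ⨍ w in Metric.closedBall y s, f w|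
      ≤ M * volume.real (Metric.closedBall y s)) :
    ∀ y s, 0 < s → ∫ z in Metric.closedBall y s, (f z - ⨍ w in Metric.closedBall y s, f w) ^ 2
      ≤ 3 * (4 * 4 ^ d * (2 * 4 ^ d) * (2 * M)) ^ 2 * volume.real (Metric.closedBall y s) := by
  intro y s hs
  set t : ℕ → ℝ → ℝ := fun n a => max (-(n:ℝ)) (min a n) with ht
  have htl : ∀ n a b, |t n a - t n b| ≤ |a - b| := by
    intro n a b
    have := ((LipschitzWith.id (α := ℝ)).min_const (n:ℝ)).const_max (-(n:ℝ))
    have h := this.dist_le_mul a b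
    simpa [Real.dist_eq] using h
  have htb : ∀ n a, |t n a| ≤ n := by
    intro n a
    have hn : (0:ℝ) ≤ n := Nat.cast_nonneg n
    rw [abs_le]
    exact ⟨le_max_left _ _, max_le (by linarith) (min_le_right _ _)⟩
  have htc : ∀ n, Continuous (t n) := fun n => by fun_prop
  have ht0 : ∀ n a, |t n a| ≤ |a| := by
    intro n a
    have := htl n a 0
    simpa [ht] using this
  have hte : ∀ a, ∀ᶠ n in Filter.atTop, t n a = a := by
    intro a
    filter_upwards [Filter.eventually_ge_atTop ⌈|a|⌉₊] with n hn
    have h1 : |a| ≤ n := (Nat.le_ceil _).trans (by exact_mod_cast hn)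
    rw [abs_le] at h1
    simp only [ht]
    rw [min_eq_left h1.2, max_eq_right h1.1]
  have htm : ∀ n, AEStronglyMeasurable (fun z => t n (f z)) volume := fun n =>
    (htc n).comp_aestronglyMeasurable hf.aestronglyMeasurable
  have htL : ∀ n, LocallyIntegrable (fun z => t n (f z)) volume := fun n =>
    (memLp_top_of_bound (htm n) n (Filter.Eventually.of_forall fun z => htb n _)).locallyIntegrable
      le_top
  have hI : ∀ {g : EuclideanSpace ℝ (Fin d) → ℝ}, LocallyIntegrable g volume → ∀ y s,
      IntegrableOn g (Metric.closedBall y s) volume := fun hg y s =>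
    hg.integrableOn_isCompact (isCompact_closedBall y s)
  have hcst : ∀ (a : ℝ) y s, IntegrableOn (fun _ => a) (Metric.closedBall y s)
      (volume : Measure (EuclideanSpace ℝ (Fin d))) := fun a y s =>
    integrableOn_const measure_closedBall_lt_top.ne
  have hb : ∀ n y s, 0 < s →
      ∫ z in Metric.closedBall y s, |t n (f z) - ⨍ w in Metric.closedBall y s, t n (f w)|
      ≤ 2 * M * volume.real (Metric.closedBall y s) := by
    intro n y s hs
    have h1 := hbmo y s hs
    set A := ⨍ w in Metric.closedBall y s, f w
    have h2 := aux_avg hs (hI (htL n) y s) (t n A)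
    set A' := ⨍ w in Metric.closedBall y s, t n (f w)
    have i1 : ∀ a, IntegrableOn (fun z => |t n (f z) - a|) (Metric.closedBall y s) volume :=
      fun a => ((hI (htL n) y s).sub (hcst a y s)).abs
    have h3 : ∫ z in Metric.closedBall y s, |t n (f z) - t n A| ≤
        ∫ z in Metric.closedBall y s, |f z - A| :=
      integral_mono (i1 _) ((hI hf y s).sub (hcst A y s)).abs (fun z => htl n _ _)
    have h4 : ∫ z in Metric.closedBall y s, |t n (f z) - A'| ≤
        ∫ z in Metric.closedBall y s, (|t n (f z) - t n A| + |A' - t n A|) := by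
      refine integral_mono (i1 _) ((i1 _).add (hcst _ _ _)) fun z => ?_
      have := abs_sub_le (t n (f z)) (t n A) A'
      rwa [abs_sub_comm (t n A) A'] at this
    rw [integral_add (i1 _) (hcst _ _ _), setIntegral_const, smul_eq_mul] at h4
    linarith
  have hA : Filter.Tendsto (fun n => ⨍ w in Metric.closedBall y s, t n (f w)) Filter.atTop
      (nhds (⨍ w in Metric.closedBall y s, f w)) := by
    simp only [setAverage_eq]
    refine Filter.Tendsto.const_smul ?_ _
    refine tendsto_integral_of_dominated_convergence (fun z => |f z|)
      (fun n => (htm n).restrict) (hI hf y s).abs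
      (fun n => Filter.Eventually.of_forall fun z => ht0 n _)
      (Filter.Eventually.of_forall fun z => ?_)
    exact tendsto_const_nhds.congr' ((hte (f z)).mono fun n hn => hn.symm)
  obtain ⟨B, hB⟩ := hA.norm.bddAbove_range
  have hB' : ∀ n, |⨍ w in Metric.closedBall y s, t n (f w)| ≤ B := fun n =>
    hB (Set.mem_range_self n)
  have hlim : Filter.Tendsto (fun n => ∫ z in Metric.closedBall y s,
      (t n (f z) - ⨍ w in Metric.closedBall y s, t n (f w)) ^ 2) Filter.atTop
      (nhds (∫ z in Metric.closedBall y s, (f z - ⨍ w in Metric.closedBall y s, f w) ^ 2)) := by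
    refine tendsto_integral_of_dominated_convergence (fun z => 2 * f z ^ 2 + 2 * B ^ 2)
      (fun n => (((htm n).restrict).sub aestronglyMeasurable_const).pow 2)
      (((hI hf2 y s).const_mul 2).add (hcst _ _ _))
      (fun n => Filter.Eventually.of_forall fun z => ?_)
      (Filter.Eventually.of_forall fun z => ?_)
    · have h1 := ht0 n (f z)
      have h2 := hB' n
      rw [Real.norm_eq_abs, abs_pow, sq_abs]
      have h3 := sq_le_sq.2 h1
      have h4 : (⨍ w in Metric.closedBall y s, t n (f w)) ^ 2 ≤ B ^ 2 :=
        sq_le_sq.2 (h2.trans (le_abs_self B))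
      nlinarith [sq_nonneg (t n (f z) + ⨍ w in Metric.closedBall y s, t n (f w))]
    · exact ((tendsto_const_nhds.congr' ((hte (f z)).mono fun n hn => hn.symm)).sub hA).pow 2
  exact le_of_tendsto' hlim fun n =>
    aux_jn_bdd (htm n) (fun z => htb n _) (by positivity) (hb n) y s hs


theorem aux_sigma {σ : Matrix (Fin d) (Fin d) ℝ} (hs : ∀ i j, σ i j = σ j i)
    (h : ∀ y : Fin d → ℝ, |∑ i, ∑ j, σ i j * y i * y j| ≤ ∑ i, y i ^ 2) (i j : Fin d) :
    |σ i j| ≤ 3 := by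
  have hd : ∀ i, |σ i i| ≤ 1 := by
    intro i
    have := h (Pi.single i 1)
    simpa [Pi.single_apply] using this
  by_cases hij : i = j
  · subst hij; linarith [hd i]
  · have h1 := h (Pi.single i 1 + Pi.single j 1)
    have e1 : ∑ a, ∑ b, σ a b * (Pi.single i 1 + Pi.single j 1 : Fin d → ℝ) a *
        (Pi.single i 1 + Pi.single j 1 : Fin d → ℝ) b = σ i i + σ i j + (σ j i + σ j j) := by
      simp [Pi.single_apply, mul_add, Finset.sum_add_distrib]
      ring
    have e2 : ∑ a, (Pi.single i 1 + Pi.single j 1 : Fin d → ℝ) a ^ 2 = 2 := by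
      have : ∀ a, (Pi.single i 1 + Pi.single j 1 : Fin d → ℝ) a ^ 2 =
          (Pi.single i 1 : Fin d → ℝ) a + (Pi.single j 1 : Fin d → ℝ) a := by
        intro a
        simp only [Pi.add_apply, Pi.single_apply]
        by_cases h1 : a = i <;> by_cases h2 : a = j <;> simp_all
      simp only [this, Finset.sum_add_distrib]
      simp
      norm_num
    rw [e1, e2, hs j i] at h1
    have h2 := hd i
    have h3 := hd j
    rw [abs_le] at *
    constructor <;> linarith

theorem aux_approx {k : EuclideanSpace ℝ (Fin d) → ℝ} (hk : Continuous k)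
    (hkc : HasCompactSupport k) {δ : ℝ} (hδ : 0 < δ) :
    ∃ κ : EuclideanSpace ℝ (Fin d) → ℝ, ContDiff ℝ ∞ κ ∧ HasCompactSupport κ ∧
      ∀ x, |κ x - k x| ≤ δ := by
  have hu : UniformContinuous k := hkc.uniformContinuous_of_continuous hk
  obtain ⟨ε, hε, hfε⟩ := Metric.uniformContinuous_iff.mp hu δ hδ
  obtain ⟨g, hgc, hg⟩ := hk.exists_contDiff_dist_le_of_forall_mem_ball_dist_le hε
  refine ⟨g, hgc, ?_, fun x => hg x δ fun y hy => (hfε hy).le⟩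
  refine HasCompactSupport.intro (K := Metric.cthickening ε (tsupport k))
    (IsCompact.cthickening hkc) fun x hx => ?_
  have h0 : ∀ y ∈ Metric.ball x ε, k y = 0 := by
    intro y hy
    by_contra hne
    apply hx
    exact Metric.mem_cthickening_of_dist_le x y ε _ (subset_tsupport k hne)
      (by rw [dist_comm]; exact (Metric.mem_ball.1 hy).le)
  have h1 := hg x 0 (fun y hy => by
    rw [h0 y hy, h0 x (Metric.mem_ball_self hε)]; simp)
  rw [h0 x (Metric.mem_ball_self hε)] at h1
  simpa using h1

theorem aux_deriv {κ : EuclideanSpace ℝ (Fin d) → ℝ} (hκ : ContDiff ℝ ∞ κ)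
    (hκc : HasCompactSupport κ) {p : EuclideanSpace ℝ (Fin d) → ℝ} (hp : Integrable p volume)
    (x e : EuclideanSpace ℝ (Fin d)) (t : ℝ) :
    HasDerivAt (fun t : ℝ => ∫ y, κ (x + t • e - y) * p y)
      (∫ y, fderiv ℝ κ (x + t • e - y) e * p y) t := by
  have hfc : Continuous (fun z => fderiv ℝ κ z e) :=
    (hκ.continuous_fderiv (by simp)).clm_apply continuous_const
  have hfs : HasCompactSupport (fun z => fderiv ℝ κ z e) :=
    hκc.fderiv_apply (𝕜 := ℝ) e
  obtain ⟨C, hC⟩ := hfs.exists_bound_of_continuous hfc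
  obtain ⟨C', hC'⟩ := hκc.exists_bound_of_continuous hκ.continuous
  refine (hasDerivAt_integral_of_dominated_loc_of_deriv_le (s := Set.univ)
    (F' := fun t y => fderiv ℝ κ (x + t • e - y) e * p y)
    (bound := fun y => C * ‖p y‖) Filter.univ_mem ?_ ?_ ?_ ?_ ?_ ?_).2
  · refine Filter.Eventually.of_forall fun t => ?_
    exact (hκ.continuous.comp (by fun_prop : Continuous fun y => x + t • e - y)).aestronglyMeasurable.mul hp.1
  · exact hp.bdd_mul (c := C') (hκ.continuous.comp (by fun_prop : Continuous fun y => x + t • e - y)).aestronglyMeasurable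
      (Filter.Eventually.of_forall fun y => hC' _)
  · exact (hfc.comp (by fun_prop : Continuous fun y => x + t • e - y)).aestronglyMeasurable.mul hp.1
  · refine Filter.Eventually.of_forall fun y t _ => ?_
    rw [norm_mul]
    exact mul_le_mul_of_nonneg_right (hC _) (norm_nonneg _)
  · exact hp.norm.const_mul C
  · refine Filter.Eventually.of_forall fun y t _ => ?_
    have h1 : HasDerivAt (fun t : ℝ => x + t • e - y) e t := by
      have := (((hasDerivAt_id t).smul_const e).const_add x).sub_const y
      simpa using this
    have h2 := ((hκ.differentiable (by simp)) (x + t • e - y)).hasFDerivAt.comp_hasDerivAt t h1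
    exact h2.mul_const (p y)

theorem aux_smooth_bound {κ : EuclideanSpace ℝ (Fin d) → ℝ} (hκ : ContDiff ℝ ∞ κ)
    (hκc : HasCompactSupport κ)
    {u : EuclideanSpace ℝ (Fin d) → EuclideanSpace ℝ (Fin d)} (hu : Integrable u volume)
    {ν : Measure (EuclideanSpace ℝ (Fin d))} [IsFiniteMeasure ν]
    {σ : EuclideanSpace ℝ (Fin d) → Matrix (Fin d) (Fin d) ℝ}
    (hσ : ∀ x i j, |σ x i j| ≤ 3)
    (hE : ∀ i j, ∀ φ : EuclideanSpace ℝ (Fin d) → ℝ, ContDiff ℝ ∞ φ → HasCompactSupport φ →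
        (∫ x, φ x * σ x i j ∂ν)
          = -(1 / 2) * ∫ x, (u x i * fderiv ℝ φ x (EuclideanSpace.single j 1)
              + u x j * fderiv ℝ φ x (EuclideanSpace.single i 1)) ∂volume)
    (x e : EuclideanSpace ℝ (Fin d)) :
    |∫ y, fderiv ℝ κ (x - y) e * ∑ i, e i * u y i|
      ≤ (∑ i, ∑ j, |e i * e j| * 3) * ∫ y, |κ (x - y)| ∂ν := by
  set φ : EuclideanSpace ℝ (Fin d) → ℝ := fun y => κ (x - y) with hφ
  have hφs : ContDiff ℝ ∞ φ := hκ.comp (contDiff_const.sub contDiff_id)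
  have hφc : HasCompactSupport φ := by
    exact hκc.comp_homeomorph (Homeomorph.subLeft x)
  have hφd : ∀ y w, fderiv ℝ φ y w = - fderiv ℝ κ (x - y) w := by
    intro y w
    have h1 : HasFDerivAt (fun y => x - y) (-(ContinuousLinearMap.id ℝ (EuclideanSpace ℝ (Fin d)))) y :=
      (hasFDerivAt_id y).const_sub x
    have h2 : HasFDerivAt φ _ y := ((hκ.differentiable (by simp)) (x - y)).hasFDerivAt.comp y h1
    rw [h2.fderiv]
    simp
  have hui : ∀ i, Integrable (fun y => u y i) volume := fun i =>
    (EuclideanSpace.proj i : EuclideanSpace ℝ (Fin d) →L[ℝ] ℝ).integrable_comp hu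
  have hint : ∀ i w, Integrable (fun y => u y i * fderiv ℝ φ y w) volume := by
    intro i w
    have hfc : Continuous (fun z => fderiv ℝ φ z w) :=
      (hφs.continuous_fderiv (by simp)).clm_apply continuous_const
    have hfs : HasCompactSupport (fun z => fderiv ℝ φ z w) := hφc.fderiv_apply (𝕜 := ℝ) w
    obtain ⟨C, hC⟩ := hfs.exists_bound_of_continuous hfc
    exact (hui i).mul_bdd (c := C) hfc.aestronglyMeasurable (Filter.Eventually.of_forall hC)
  set a : Fin d → Fin d → ℝ := fun i j => ∫ y, u y i * fderiv ℝ φ y (EuclideanSpace.single j 1)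
    with ha
  have hL : ∀ i j, ∫ x, φ x * σ x i j ∂ν = -(1/2) * (a i j + a j i) := by
    intro i j
    rw [hE i j φ hφs hφc, integral_add (hint _ _) (hint _ _)]
  have hF : ∫ y, fderiv ℝ κ (x - y) e * ∑ i, e i * u y i = - ∑ i, ∑ j, e i * e j * a i j := by
    have h1 : ∀ y, fderiv ℝ κ (x - y) e * ∑ i, e i * u y i =
        ∑ i, ∑ j, (-(e i * e j)) * (u y i * fderiv ℝ φ y (EuclideanSpace.single j 1)) := by
      intro y
      have h2 : fderiv ℝ φ y e = ∑ j, e j * fderiv ℝ φ y (EuclideanSpace.single j 1) := by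
        have he : e = ∑ j, e j • EuclideanSpace.single j (1:ℝ) := by
          ext k
          simp [Finset.sum_apply, Pi.single_apply]
        conv_lhs => rw [he]
        simp
      have h3 : fderiv ℝ κ (x - y) e = - fderiv ℝ φ y e := by rw [hφd]; simp
      rw [h3, h2, ← Finset.sum_neg_distrib, Finset.sum_mul_sum, Finset.sum_comm]
      refine Finset.sum_congr rfl fun i _ => Finset.sum_congr rfl fun j _ => ?_
      ring
    simp only [h1]
    rw [integral_finsetSum _ fun i _ => integrable_finsetSum _ fun j _ => (hint i _).const_mul _,
      ← Finset.sum_neg_distrib]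
    refine Finset.sum_congr rfl fun i _ => ?_
    rw [integral_finsetSum _ fun j _ => (hint i _).const_mul _, ← Finset.sum_neg_distrib]
    refine Finset.sum_congr rfl fun j _ => ?_
    rw [integral_const_mul]
    ring
  have hF2 : ∫ y, fderiv ℝ κ (x - y) e * ∑ i, e i * u y i =
      ∑ i, ∑ j, e i * e j * ∫ x, φ x * σ x i j ∂ν := by
    rw [hF]
    simp only [hL]
    have h1 : ∑ i, ∑ j, e i * e j * a j i = ∑ i, ∑ j, e i * e j * a i j := by
      rw [Finset.sum_comm]
      refine Finset.sum_congr rfl fun i _ => Finset.sum_congr rfl fun j _ => ?_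
      ring
    have h2 : ∑ i, ∑ j, e i * e j * (-(1/2) * (a i j + a j i)) =
        -(1/2) * ∑ i, ∑ j, e i * e j * a i j + -(1/2) * ∑ i, ∑ j, e i * e j * a j i := by
      simp only [Finset.mul_sum, ← Finset.sum_add_distrib]
      refine Finset.sum_congr rfl fun i _ => Finset.sum_congr rfl fun j _ => ?_
      ring
    rw [h2, h1]; ring
  have hLb : ∀ i j, |∫ x, φ x * σ x i j ∂ν| ≤ 3 * ∫ y, |φ y| ∂ν := by
    intro i j
    rw [← integral_const_mul, ← Real.norm_eq_abs]
    refine norm_integral_le_of_norm_le ?_ (Filter.Eventually.of_forall fun y => ?_)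
    · obtain ⟨C', hC'⟩ := hφc.exists_bound_of_continuous hφs.continuous
      exact ((Integrable.of_bound hφs.continuous.aestronglyMeasurable C'
        (Filter.Eventually.of_forall hC')).abs).const_mul 3
    · rw [norm_mul, mul_comm, Real.norm_eq_abs, Real.norm_eq_abs]
      exact mul_le_mul_of_nonneg_right (hσ _ _ _) (abs_nonneg _)
  rw [hF2, Finset.sum_mul]
  refine (Finset.abs_sum_le_sum_abs _ _).trans (Finset.sum_le_sum fun i _ => ?_)
  rw [Finset.sum_mul]
  refine (Finset.abs_sum_le_sum_abs _ _).trans (Finset.sum_le_sum fun j _ => ?_)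
  rw [abs_mul, mul_assoc]
  exact mul_le_mul_of_nonneg_left (hLb i j) (abs_nonneg _)


theorem aux_bound_line {k : EuclideanSpace ℝ (Fin d) → ℝ} (hk : Continuous k)
    (hkc : HasCompactSupport k) (hk0 : ∀ x, 0 ≤ k x)
    {u : EuclideanSpace ℝ (Fin d) → EuclideanSpace ℝ (Fin d)} (hu : Integrable u volume)
    {ν : Measure (EuclideanSpace ℝ (Fin d))} [IsFiniteMeasure ν]
    {σ : EuclideanSpace ℝ (Fin d) → Matrix (Fin d) (Fin d) ℝ}
    (hσ : ∀ x i j, |σ x i j| ≤ 3)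
    (hE : ∀ i j, ∀ φ : EuclideanSpace ℝ (Fin d) → ℝ, ContDiff ℝ ∞ φ → HasCompactSupport φ →
        (∫ x, φ x * σ x i j ∂ν)
          = -(1 / 2) * ∫ x, (u x i * fderiv ℝ φ x (EuclideanSpace.single j 1)
              + u x j * fderiv ℝ φ x (EuclideanSpace.single i 1)) ∂volume)
    (x e : EuclideanSpace ℝ (Fin d)) {h B : ℝ} (hh : 0 ≤ h)
    (hB : ∀ t ∈ Set.Icc 0 h, ∫ y, k (x + t • e - y) ∂ν ≤ B) :
    |(∫ y, k (x + h • e - y) * ∑ i, e i * u y i) - ∫ y, k (x - y) * ∑ i, e i * u y i|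
      ≤ (∑ i, ∑ j, |e i * e j| * 3) * B * h := by
  set p : EuclideanSpace ℝ (Fin d) → ℝ := fun y => ∑ i, e i * u y i with hp
  have hui : ∀ i, Integrable (fun y => u y i) volume := fun i =>
    (EuclideanSpace.proj i : EuclideanSpace ℝ (Fin d) →L[ℝ] ℝ).integrable_comp hu
  have hpi : Integrable p volume := integrable_finsetSum _ fun i _ => (hui i).const_mul _
  set c := ∑ i, ∑ j, |e i * e j| * 3 with hc
  have hc0 : 0 ≤ c := Finset.sum_nonneg fun i _ => Finset.sum_nonneg fun j _ => by positivity
  have key : ∀ δ : ℝ, 0 < δ →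
      |(∫ y, k (x + h • e - y) * p y) - ∫ y, k (x - y) * p y|
      ≤ c * (B + δ * ν.real Set.univ) * h + 2 * (δ * ∫ y, |p y|) := by
    intro δ hδ
    obtain ⟨κ, hκ, hκc, hκk⟩ := aux_approx hk hkc hδ
    have hbd : ∀ {q : EuclideanSpace ℝ (Fin d) → ℝ}, Continuous q → HasCompactSupport q →
        ∀ z, Integrable (fun y => q (z - y) * p y) volume := by
      intro q hq hqc z
      obtain ⟨C', hC'⟩ := hqc.exists_bound_of_continuous hq
      exact hpi.bdd_mul (c := C') (hq.comp (by fun_prop : Continuous fun y => z - y)).aestronglyMeasurable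
        (Filter.Eventually.of_forall fun y => hC' _)
    have hbd2 : ∀ {q : EuclideanSpace ℝ (Fin d) → ℝ}, Continuous q → HasCompactSupport q →
        ∀ z, Integrable (fun y => q (z - y)) ν := by
      intro q hq hqc z
      obtain ⟨C', hC'⟩ := hqc.exists_bound_of_continuous hq
      exact Integrable.of_bound (hq.comp (by fun_prop : Continuous fun y => z - y)).aestronglyMeasurable C'
        (Filter.Eventually.of_forall fun y => hC' _)
    have hdiff : ∀ z, |(∫ y, κ (z - y) * p y) - ∫ y, k (z - y) * p y| ≤ δ * ∫ y, |p y| := by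
      intro z
      rw [← integral_sub (hbd hκ.continuous hκc z) (hbd hk hkc z), ← integral_const_mul,
        ← Real.norm_eq_abs]
      refine norm_integral_le_of_norm_le (hpi.abs.const_mul δ) (Filter.Eventually.of_forall fun y => ?_)
      rw [← sub_mul, norm_mul]
      exact mul_le_mul_of_nonneg_right (hκk _) (abs_nonneg _)
    have hmv := norm_image_sub_le_of_norm_deriv_le_segment' (a := 0) (b := h)
      (f := fun t : ℝ => ∫ y, κ (x + t • e - y) * p y)
      (f' := fun t : ℝ => ∫ y, fderiv ℝ κ (x + t • e - y) e * p y)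
      (C := c * (B + δ * ν.real Set.univ))
      (fun t _ => (aux_deriv hκ hκc hpi x e t).hasDerivWithinAt)
      (fun t ht => by
        refine (aux_smooth_bound hκ hκc hu hσ hE (x + t • e) e).trans ?_
        refine mul_le_mul_of_nonneg_left ?_ hc0
        have h1 : ∫ y, |κ (x + t • e - y)| ∂ν ≤ ∫ y, (k (x + t • e - y) + δ) ∂ν := by
          refine integral_mono (hbd2 hκ.continuous hκc _).abs ((hbd2 hk hkc _).add (integrable_const δ))
            fun y => ?_
          have h2 := hκk (x + t • e - y)
          have h3 := abs_sub_abs_le_abs_sub (κ (x + t • e - y)) (k (x + t • e - y))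
          rw [abs_of_nonneg (hk0 _)] at h3
          show |κ (x + t • e - y)| ≤ k (x + t • e - y) + δ
          linarith
        rw [integral_add (hbd2 hk hkc _) (integrable_const δ), integral_const, smul_eq_mul] at h1
        have := hB t ⟨ht.1, ht.2.le⟩
        linarith) h ⟨hh, le_rfl⟩
    simp only [zero_smul, add_zero, sub_zero, Real.norm_eq_abs] at hmv
    have h1 := hdiff (x + h • e)
    have h2 := hdiff x
    rw [abs_le] at *
    constructor <;> linarith
  have hlim : Filter.Tendsto (fun δ : ℝ => c * (B + δ * ν.real Set.univ) * h + 2 * (δ * ∫ y, |p y|))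
      (nhdsWithin 0 (Set.Ioi 0)) (nhds (c * B * h)) := by
    have : Continuous (fun δ : ℝ => c * (B + δ * ν.real Set.univ) * h + 2 * (δ * ∫ y, |p y|)) := by
      fun_prop
    have h2 := (this.tendsto 0).mono_left (nhdsWithin_le_nhds (s := Set.Ioi 0))
    simpa using h2
  exact ge_of_tendsto hlim (by
    filter_upwards [self_mem_nhdsWithin] with δ hδ using key δ hδ)

theorem aux_g_cont {k : EuclideanSpace ℝ (Fin d) → ℝ} (hk : Continuous k)
    (hkc : HasCompactSupport k) (ν : Measure (EuclideanSpace ℝ (Fin d))) [IsFiniteMeasure ν] :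
    Continuous (fun x => ∫ y, k (x - y) ∂ν) := by
  obtain ⟨C', hC'⟩ := hkc.exists_bound_of_continuous hk
  refine continuous_of_dominated (bound := fun _ => C') (fun x => ?_) (fun x => ?_)
    (integrable_const _) ?_
  · exact (hk.comp (by fun_prop : Continuous fun y => x - y)).aestronglyMeasurable
  · exact Filter.Eventually.of_forall fun y => hC' _
  · exact Filter.Eventually.of_forall fun y => by fun_prop

theorem aux_quad {k : EuclideanSpace ℝ (Fin d) → ℝ} (hk : Continuous k)
    (hkc : HasCompactSupport k) (hk0 : ∀ x, 0 ≤ k x)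
    {u : EuclideanSpace ℝ (Fin d) → EuclideanSpace ℝ (Fin d)} (hu : Integrable u volume)
    {ν : Measure (EuclideanSpace ℝ (Fin d))} [IsFiniteMeasure ν]
    {σ : EuclideanSpace ℝ (Fin d) → Matrix (Fin d) (Fin d) ℝ}
    (hσ : ∀ x i j, |σ x i j| ≤ 3)
    (hE : ∀ i j, ∀ φ : EuclideanSpace ℝ (Fin d) → ℝ, ContDiff ℝ ∞ φ → HasCompactSupport φ →
        (∫ x, φ x * σ x i j ∂ν)
          = -(1 / 2) * ∫ x, (u x i * fderiv ℝ φ x (EuclideanSpace.single j 1)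
              + u x j * fderiv ℝ φ x (EuclideanSpace.single i 1)) ∂volume)
    (x e : EuclideanSpace ℝ (Fin d))
    (hd : DifferentiableAt ℝ (fun x => ∫ y, k (x - y) • u y) x) :
    |∑ i, e i * (fderiv ℝ (fun x => ∫ y, k (x - y) • u y) x e) i|
      ≤ (∑ i, ∑ j, |e i * e j| * 3) * ∫ y, k (x - y) ∂ν := by
  set W := fun x => ∫ y, k (x - y) • u y with hW
  set c := ∑ i, ∑ j, |e i * e j| * 3 with hc
  have hc0 : 0 ≤ c := Finset.sum_nonneg fun i _ => Finset.sum_nonneg fun j _ => by positivity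
  have hui : ∀ i, Integrable (fun y => u y i) volume := fun i =>
    (EuclideanSpace.proj i : EuclideanSpace ℝ (Fin d) →L[ℝ] ℝ).integrable_comp hu
  obtain ⟨C', hC'⟩ := hkc.exists_bound_of_continuous hk
  have hmeas : ∀ z, AEStronglyMeasurable (fun y => k (z - y)) volume := fun z =>
    (hk.comp (by fun_prop : Continuous fun y => z - y)).aestronglyMeasurable
  have hku : ∀ z, Integrable (fun y => k (z - y) • u y) volume := fun z =>
    hu.bdd_smul C' (hmeas z) (Filter.Eventually.of_forall fun y => hC' _)
  have hWi : ∀ z i, W z i = ∫ y, k (z - y) * u y i := by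
    intro z i
    have := (EuclideanSpace.proj i : EuclideanSpace ℝ (Fin d) →L[ℝ] ℝ).integral_comp_comm (hku z)
    simpa using this.symm
  set l : EuclideanSpace ℝ (Fin d) →L[ℝ] ℝ :=
    ∑ i, e i • (EuclideanSpace.proj i : EuclideanSpace ℝ (Fin d) →L[ℝ] ℝ) with hl
  have hla : ∀ w, l w = ∑ i, e i * w i := by
    intro w; simp [hl]
  have hlW : ∀ z, l (W z) = ∫ y, k (z - y) * ∑ i, e i * u y i := by
    intro z
    rw [hla]
    simp only [hWi, Finset.mul_sum, ← integral_const_mul]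
    rw [← integral_finsetSum]
    · refine integral_congr_ae (Filter.Eventually.of_forall fun y => ?_)
      exact Finset.sum_congr rfl fun i _ => by ring
    · intro i _
      exact ((hui i).bdd_mul (c := C') (hmeas z) (Filter.Eventually.of_forall fun y => hC' _)).const_mul _
  have hder : HasDerivAt (fun t : ℝ => l (W (x + t • e))) (l (fderiv ℝ W x e)) 0 := by
    have h1 : HasDerivAt (fun t : ℝ => x + t • e) e 0 := by
      have := ((hasDerivAt_id (0:ℝ)).smul_const e).const_add x
      simpa using this
    have h2 : HasFDerivAt W (fderiv ℝ W x) (x + (0:ℝ) • e) := by simpa using hd.hasFDerivAt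
    have h3 : HasDerivAt (fun t : ℝ => W (x + t • e)) (fderiv ℝ W x e) 0 :=
      HasFDerivAt.comp_hasDerivAt (l := W) (0:ℝ) h2 h1
    exact HasFDerivAt.comp_hasDerivAt (l := l) (0:ℝ) l.hasFDerivAt h3
  rw [← hla]
  have hg := aux_g_cont hk hkc ν
  refine le_of_forall_pos_le_add fun η hη => ?_
  have hη' : 0 < η / (c + 1) := by positivity
  have hsl := hder.tendsto_slope_zero_right.norm
  have hev : ∀ᶠ h : ℝ in nhdsWithin 0 (Set.Ioi 0), ∀ t ∈ Set.Icc 0 h,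
      ∫ y, k (x + t • e - y) ∂ν ≤ (∫ y, k (x - y) ∂ν) + η / (c + 1) := by
    have hcont : Continuous (fun t : ℝ => ∫ y, k (x + t • e - y) ∂ν) :=
      hg.comp (by fun_prop : Continuous fun t : ℝ => x + t • e)
    have h1 : ∀ᶠ t : ℝ in nhds 0, ∫ y, k (x + t • e - y) ∂ν < (∫ y, k (x - y) ∂ν) + η / (c + 1) := by
      refine hcont.continuousAt.eventually (gt_mem_nhds ?_)
      simpa using hη'
    obtain ⟨ε, hε, hball⟩ := Metric.eventually_nhds_iff.1 h1
    filter_upwards [Ioo_mem_nhdsGT hε] with h hh t ht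
    refine (hball ?_).le
    rw [Real.dist_eq, sub_zero, abs_of_nonneg ht.1]
    exact ht.2.trans_lt hh.2
  have hfin : |l (fderiv ℝ W x e)| ≤ c * ((∫ y, k (x - y) ∂ν) + η / (c + 1)) := by
    refine le_of_tendsto hsl ?_
    filter_upwards [hev, self_mem_nhdsWithin] with h hh hpos
    have hpos' : 0 < h := hpos
    have h1 := aux_bound_line hk hkc hk0 hu hσ hE x e hpos'.le hh
    rw [← hlW, ← hlW] at h1
    simp only [zero_add, zero_smul, add_zero]
    rw [norm_smul, norm_inv, Real.norm_eq_abs, Real.norm_eq_abs, abs_of_pos hpos',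
      inv_mul_le_iff₀ hpos', mul_comm h]
    exact h1
  refine hfin.trans ?_
  rw [mul_add]
  have : c * (η / (c + 1)) ≤ η := by
    rw [← mul_div_assoc, div_le_iff₀ (by positivity)]
    nlinarith
  linarith

theorem aux_sym {k : EuclideanSpace ℝ (Fin d) → ℝ} (hk : Continuous k)
    (hkc : HasCompactSupport k) (hk0 : ∀ x, 0 ≤ k x)
    {u : EuclideanSpace ℝ (Fin d) → EuclideanSpace ℝ (Fin d)} (hu : Integrable u volume)
    {ν : Measure (EuclideanSpace ℝ (Fin d))} [IsFiniteMeasure ν]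
    {σ : EuclideanSpace ℝ (Fin d) → Matrix (Fin d) (Fin d) ℝ}
    (hσ : ∀ x i j, |σ x i j| ≤ 3)
    (hE : ∀ i j, ∀ φ : EuclideanSpace ℝ (Fin d) → ℝ, ContDiff ℝ ∞ φ → HasCompactSupport φ →
        (∫ x, φ x * σ x i j ∂ν)
          = -(1 / 2) * ∫ x, (u x i * fderiv ℝ φ x (EuclideanSpace.single j 1)
              + u x j * fderiv ℝ φ x (EuclideanSpace.single i 1)) ∂volume)
    (x : EuclideanSpace ℝ (Fin d)) (i j : Fin d) :
    |(fderiv ℝ (fun x => ∫ y, k (x - y) • u y) x (EuclideanSpace.single i 1)) j +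
      (fderiv ℝ (fun x => ∫ y, k (x - y) • u y) x (EuclideanSpace.single j 1)) i|
      ≤ 18 * ∫ y, k (x - y) ∂ν := by
  have hg0 : 0 ≤ ∫ y, k (x - y) ∂ν := integral_nonneg fun y => hk0 _
  by_cases hd : DifferentiableAt ℝ (fun x => ∫ y, k (x - y) • u y) x
  swap
  · rw [fderiv_zero_of_not_differentiableAt hd]
    simpa using hg0
  have hq := fun e => aux_quad hk hkc hk0 hu hσ hE x e hd
  set D := fderiv ℝ (fun x => ∫ y, k (x - y) • u y) x
  set g := ∫ y, k (x - y) ∂ν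
  have hdiag : ∀ i, |(D (EuclideanSpace.single i 1)) i| ≤ 3 * g := by
    intro i
    have := hq (EuclideanSpace.single i 1)
    have e1 : ∑ a, (EuclideanSpace.single i (1:ℝ)) a * (D (EuclideanSpace.single i 1)) a
        = (D (EuclideanSpace.single i 1)) i := by simp [Pi.single_apply]
    have e2 : ∑ a, ∑ b, |(EuclideanSpace.single i (1:ℝ)) a * (EuclideanSpace.single i (1:ℝ)) b| * 3
        = 3 := by
      simp [Pi.single_apply, abs_mul, apply_ite abs, Finset.sum_ite_eq']
    rwa [e1, e2] at this
  have h1 := hq (EuclideanSpace.single i 1 + EuclideanSpace.single j 1)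
  have e1 : ∑ a, (EuclideanSpace.single i (1:ℝ) + EuclideanSpace.single j (1:ℝ)) a *
      (D (EuclideanSpace.single i 1 + EuclideanSpace.single j 1)) a
      = (D (EuclideanSpace.single i 1)) i + (D (EuclideanSpace.single i 1)) j
        + ((D (EuclideanSpace.single j 1)) i + (D (EuclideanSpace.single j 1)) j) := by
    rw [map_add]
    simp [add_mul, mul_add, Finset.sum_add_distrib]
  have e2 : ∑ a, ∑ b, |(EuclideanSpace.single i (1:ℝ) + EuclideanSpace.single j (1:ℝ)) a *
      (EuclideanSpace.single i (1:ℝ) + EuclideanSpace.single j (1:ℝ)) b| * 3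
        = 12 := by
    have hn : ∀ a, 0 ≤ (EuclideanSpace.single i (1:ℝ) + EuclideanSpace.single j (1:ℝ)) a := by
      intro a
      simp only [PiLp.add_apply, PiLp.single_apply]
      split_ifs <;> norm_num
    have hn2 : ∀ a b, |(EuclideanSpace.single i (1:ℝ) + EuclideanSpace.single j (1:ℝ)) a *
      (EuclideanSpace.single i (1:ℝ) + EuclideanSpace.single j (1:ℝ)) b| =
      (EuclideanSpace.single i (1:ℝ) + EuclideanSpace.single j (1:ℝ)) a *
      (EuclideanSpace.single i (1:ℝ) + EuclideanSpace.single j (1:ℝ)) b := fun a b =>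
      abs_of_nonneg (mul_nonneg (hn a) (hn b))
    simp only [hn2, ← Finset.sum_mul, ← Finset.mul_sum]
    simp [Finset.sum_add_distrib, Pi.single_apply]
    norm_num
  rw [e1, e2] at h1
  have h2 := hdiag i
  have h3 := hdiag j
  rw [abs_le] at *
  constructor <;> linarith


theorem aux_comm {κ : EuclideanSpace ℝ (Fin d) → ℝ} (hκ : Continuous κ) (hκc : HasCompactSupport κ)
    (hκ0 : ∀ y, 0 ≤ κ y) (hκ1 : ∫ y, κ y = 1) {Q R : ℝ} (hQ : ∀ y, κ y ≤ Q)
    {S : Set (EuclideanSpace ℝ (Fin d))} (hS : MeasurableSet S) (hSc : IsCompact S)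
    (hκS : ∀ y, y ∉ S → κ y = 0)
    {p q : EuclideanSpace ℝ (Fin d) → ℝ} (hp : LocallyIntegrable p volume)
    (hq : LocallyIntegrable q volume) (hpp : LocallyIntegrable (fun y => p y * p y) volume)
    (hqq : LocallyIntegrable (fun y => q y * q y) volume)
    (hpq : LocallyIntegrable (fun y => p y * q y) volume) {a b : ℝ}
    (ha : ∫ y in S, (p y - a) ^ 2 ≤ R) (hb : ∫ y in S, (q y - b) ^ 2 ≤ R) :
    |(∫ y, κ y * p y) * (∫ y, κ y * q y) - ∫ y, κ y * (p y * q y)| ≤ 2 * (Q * R) := by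
  have hI : ∀ {g : EuclideanSpace ℝ (Fin d) → ℝ}, LocallyIntegrable g volume →
      Integrable (fun y => κ y * g y) volume := fun hg =>
    hg.integrable_smul_left_of_hasCompactSupport hκ hκc
  have hκi : Integrable κ volume := hκ.integrable_of_hasCompactSupport hκc
  -- expansion of the bilinear quantity
  have hexp : ∀ {p q : EuclideanSpace ℝ (Fin d) → ℝ}, LocallyIntegrable p volume →
      LocallyIntegrable q volume → LocallyIntegrable (fun y => p y * q y) volume → ∀ a b : ℝ,
      Integrable (fun y => κ y * ((p y - a) * (q y - b))) volume ∧
      ∫ y, κ y * ((p y - a) * (q y - b)) =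
        (∫ y, κ y * (p y * q y)) - a * (∫ y, κ y * q y) - b * (∫ y, κ y * p y) + a * b := by
    intro p q hp hq hpq a b
    have e : (fun y => κ y * ((p y - a) * (q y - b))) =
        fun y => κ y * (p y * q y) - a * (κ y * q y) - b * (κ y * p y) + (a * b) * κ y := by
      funext y; ring
    have i1 := hI hpq
    have i2 := (hI hq).const_mul a
    have i3 := (hI hp).const_mul b
    have i4 := hκi.const_mul (a * b)
    rw [e]
    have i12 : Integrable (fun y => κ y * (p y * q y) - a * (κ y * q y)) volume := i1.sub i2
    have i123 : Integrable (fun y => κ y * (p y * q y) - a * (κ y * q y) - b * (κ y * p y))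
      volume := i12.sub i3
    refine ⟨i123.add i4, ?_⟩
    rw [integral_add i123 i4, integral_sub i12 i3, integral_sub i1 i2,
      integral_const_mul, integral_const_mul, integral_const_mul, hκ1, mul_one]
  have hQ0 : 0 ≤ Q := (hκ0 0).trans (hQ 0)
  have hvar : ∀ {p : EuclideanSpace ℝ (Fin d) → ℝ} {a : ℝ}, LocallyIntegrable p volume →
      LocallyIntegrable (fun y => p y * p y) volume → ∫ y in S, (p y - a) ^ 2 ≤ R →
      ((∫ y, κ y * p y) - a) ^ 2 ≤ Q * R ∧
        ∫ y, κ y * ((p y - a) * (p y - a)) ≤ Q * R := by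
    intro p a hp hpp ha
    obtain ⟨i1, e1⟩ := hexp hp hp hpp a a
    obtain ⟨i2, e2⟩ := hexp hp hp hpp (∫ y, κ y * p y) (∫ y, κ y * p y)
    have h0 : 0 ≤ ∫ y, κ y * ((p y - ∫ y, κ y * p y) * (p y - ∫ y, κ y * p y)) :=
      integral_nonneg fun y => mul_nonneg (hκ0 y) (mul_self_nonneg _)
    have h1 : ∫ y, κ y * ((p y - a) * (p y - a)) ≤ Q * R := by
      have hz : ∫ y, κ y * ((p y - a) * (p y - a)) = ∫ y in S, κ y * ((p y - a) * (p y - a)) := by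
        refine (setIntegral_eq_integral_of_forall_compl_eq_zero fun y hy => ?_).symm
        rw [hκS y hy, zero_mul]
      have iS : IntegrableOn (fun y => (p y - a) ^ 2) S volume := by
        have e : (fun y => (p y - a) ^ 2) = fun y => p y * p y - (2 * a) * p y + a ^ 2 := by
          funext y; ring
        rw [e]
        exact ((hpp.integrableOn_isCompact hSc).sub
          ((hp.integrableOn_isCompact hSc).const_mul (2 * a))).add
          (integrableOn_const hSc.measure_lt_top.ne)
      rw [hz]
      calc _ ≤ ∫ y in S, Q * (p y - a) ^ 2 := by
            refine integral_mono i1.integrableOn (iS.const_mul Q) fun y => ?_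
            show κ y * ((p y - a) * (p y - a)) ≤ Q * (p y - a) ^ 2
            rw [← sq]
            exact mul_le_mul_of_nonneg_right (hQ y) (sq_nonneg _)
        _ = Q * ∫ y in S, (p y - a) ^ 2 := integral_const_mul _ _
        _ ≤ Q * R := mul_le_mul_of_nonneg_left ha hQ0
    refine ⟨?_, h1⟩
    rw [e2] at h0
    rw [e1] at h1
    nlinarith
  obtain ⟨p1, p2⟩ := hvar hp hpp ha
  obtain ⟨q1, q2⟩ := hvar hq hqq hb
  obtain ⟨-, e⟩ := hexp hp hq hpq a b
  have hmix : |∫ y, κ y * ((p y - a) * (q y - b))| ≤ Q * R := by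
    have i1 := (hexp hp hp hpp a a).1
    have i2 := (hexp hq hq hqq b b).1
    have : ‖∫ y, κ y * ((p y - a) * (q y - b))‖ ≤
        ∫ y, ((1/2) * (κ y * ((p y - a) * (p y - a))) + (1/2) * (κ y * ((q y - b) * (q y - b)))) := by
      refine norm_integral_le_of_norm_le ((i1.const_mul _).add (i2.const_mul _))
        (Filter.Eventually.of_forall fun y => ?_)
      rw [Real.norm_eq_abs, abs_mul, abs_of_nonneg (hκ0 y)]
      have : |(p y - a) * (q y - b)| ≤
          (1/2) * ((p y - a) * (p y - a)) + (1/2) * ((q y - b) * (q y - b)) := by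
        rw [abs_le]
        constructor
        · nlinarith [sq_nonneg (p y - a + (q y - b))]
        · nlinarith [sq_nonneg (p y - a - (q y - b))]
      have := mul_le_mul_of_nonneg_left this (hκ0 y)
      linarith
    rw [integral_add (i1.const_mul _) (i2.const_mul _), integral_const_mul, integral_const_mul] at this
    rw [Real.norm_eq_abs] at this
    linarith
  have e' : (∫ y, κ y * p y) * (∫ y, κ y * q y) - ∫ y, κ y * (p y * q y) =
      ((∫ y, κ y * p y) - a) * ((∫ y, κ y * q y) - b) - ∫ y, κ y * ((p y - a) * (q y - b)) := by
    rw [e]; ring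
  rw [e']
  set X := (∫ y, κ y * p y) - a
  set Y := (∫ y, κ y * q y) - b
  rw [abs_le] at *
  constructor
  · nlinarith [sq_nonneg (X + Y)]
  · nlinarith [sq_nonneg (X - Y)]

theorem aux_bmo_comp {v : EuclideanSpace ℝ (Fin d) → EuclideanSpace ℝ (Fin d)}
    (hv : LocallyIntegrable v volume) {M : ℝ}
    (hM : ∀ (x : EuclideanSpace ℝ (Fin d)) (r : ℝ), 0 < r →
        (⨍ y in Metric.ball x r, ‖v y - ⨍ z in Metric.ball x r, v z‖) ≤ M) (i : Fin d) :
    ∀ y s, 0 < s → ∫ z in Metric.closedBall y s,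
        |v z i - ⨍ w in Metric.closedBall y s, v w i|
      ≤ M * volume.real (Metric.closedBall y s) := by
  intro y s hs
  have hr : (volume : Measure (EuclideanSpace ℝ (Fin d))).restrict (Metric.ball y s) =
      volume.restrict (Metric.closedBall y s) := by
    refine Measure.restrict_congr_set ?_
    refine (Metric.ball_subset_closedBall.eventuallyLE).antisymm ?_
    rw [ae_le_set, Metric.closedBall_sdiff_ball]
    exact Measure.addHaar_sphere_of_ne_zero _ _ hs.ne'
  have h1 := hM y s hs
  rw [hr] at h1
  have hV := aux_vol_pos y hs
  have hvi : IntegrableOn v (Metric.closedBall y s) volume :=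
    hv.integrableOn_isCompact (isCompact_closedBall y s)
  have hA : ⨍ w in Metric.closedBall y s, v w i = (⨍ w in Metric.closedBall y s, v w) i := by
    rw [setAverage_eq, setAverage_eq]
    have := (EuclideanSpace.proj i : EuclideanSpace ℝ (Fin d) →L[ℝ] ℝ).integral_comp_comm hvi
    simp at this
    simp [this]
  rw [hA]
  set A := ⨍ w in Metric.closedBall y s, v w
  rw [setAverage_eq, smul_eq_mul, inv_mul_le_iff₀ hV, mul_comm] at h1
  refine le_trans ?_ h1
  have hd : IntegrableOn (fun z => v z - A) (Metric.closedBall y s) volume :=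
    hvi.sub (integrableOn_const measure_closedBall_lt_top.ne)
  refine integral_mono ?_ hd.norm fun z => ?_
  · exact ((EuclideanSpace.proj i : EuclideanSpace ℝ (Fin d) →L[ℝ] ℝ).integrable_comp hd).abs
  · have := PiLp.norm_apply_le (v z - A) i
    simpa using this

/-- Constantin–E–Titi flux bound: there is `C > 0` such that for every
`ℓ > 0`, every `v ∈ BMO(ℝ^d;ℝ^d)` (with BMO norm at most `M`) and every `u ∈ BD(ℝ^d)`
(symmetric gradient `Eu = σ ν`, `ν = |Eu|` finite),
`‖(v_ℓ ⊗ v_ℓ − (v ⊗ v)_ℓ) : ∇u_ℓ‖_{L¹} ≤ C M² ‖Eu‖_ℳ`. -/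
theorem stmt8
    (ρ : EuclideanSpace ℝ (Fin d) → ℝ) (hρc : Continuous ρ) (hρ0 : ∀ x, 0 ≤ ρ x)
    (hρsupp : Function.support ρ ⊆ Metric.ball 0 1) (hρint : ∫ x, ρ x = 1) :
    ∃ C > 0, ∀ ℓ : ℝ, 0 < ℓ →
      ∀ v : EuclideanSpace ℝ (Fin d) → EuclideanSpace ℝ (Fin d),
      LocallyIntegrable v volume →
      (∀ i j : Fin d, LocallyIntegrable (fun y => v y i * v y j) volume) →
      ∀ M : ℝ, 0 ≤ M →
      (∀ (x : EuclideanSpace ℝ (Fin d)) (r : ℝ), 0 < r →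
        (⨍ y in Metric.ball x r, ‖v y - ⨍ z in Metric.ball x r, v z‖) ≤ M) →
      ∀ u : EuclideanSpace ℝ (Fin d) → EuclideanSpace ℝ (Fin d), Integrable u volume →
      ∀ ν : Measure (EuclideanSpace ℝ (Fin d)), IsFiniteMeasure ν →
      ∀ σ : EuclideanSpace ℝ (Fin d) → Matrix (Fin d) (Fin d) ℝ,
      (∀ x i j, σ x i j = σ x j i) →
      (∀ (x : EuclideanSpace ℝ (Fin d)) (y : Fin d → ℝ),
        |∑ i, ∑ j, σ x i j * y i * y j| ≤ ∑ i, y i ^ 2) →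
      (∀ i j, ∀ φ : EuclideanSpace ℝ (Fin d) → ℝ, ContDiff ℝ ∞ φ → HasCompactSupport φ →
        (∫ x, φ x * σ x i j ∂ν)
          = -(1 / 2) * ∫ x, (u x i * fderiv ℝ φ x (EuclideanSpace.single j 1)
              + u x j * fderiv ℝ φ x (EuclideanSpace.single i 1)) ∂volume) →
      ∫ x, |∑ i, ∑ j,
          (moll ρ ℓ v x i * moll ρ ℓ v x j - moll ρ ℓ (fun y => v y i * v y j) x) *
            (fderiv ℝ (moll ρ ℓ u) x (EuclideanSpace.single i 1)) j|
        ≤ C * M ^ 2 * (ν Set.univ).toReal := by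
  have hρcs : HasCompactSupport ρ := by
    refine HasCompactSupport.intro (isCompact_closedBall (0 : EuclideanSpace ℝ (Fin d)) 1)
      fun x hx => ?_
    by_contra hne
    exact hx (Metric.ball_subset_closedBall (hρsupp hne))
  obtain ⟨P, hP⟩ := hρcs.exists_bound_of_continuous hρc
  have hP' : ∀ x, ρ x ≤ P := fun x => (le_abs_self _).trans (hP x)
  have hP0 : 0 ≤ P := (hρ0 0).trans (hP' 0)
  set om := volume.real (Metric.closedBall (0 : EuclideanSpace ℝ (Fin d)) 1) with hom
  have hom0 : 0 < om := aux_vol_pos _ one_pos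
  set C0 : ℝ := 2 * (P * (3 * (4 * 4 ^ d * (2 * 4 ^ d) * 2) ^ 2) * om) with hC0
  have hC00 : 0 ≤ C0 := by positivity
  refine ⟨∑ i : Fin d, ∑ j : Fin d, C0 * 9 + 1, by positivity, ?_⟩
  intro ℓ hℓ v hv hvv M hM hbmo u hu ν hν σ hσs hσq hE
  have hσ : ∀ x i j, |σ x i j| ≤ 3 := fun x => aux_sigma (hσs x) (hσq x)
  set k := rescale ρ ℓ with hkdef
  have hk : Continuous k := by
    show Continuous fun x => ℓ ^ (-(d : ℝ)) * ρ (ℓ⁻¹ • x)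
    fun_prop
  have hk0 : ∀ x, 0 ≤ k x := fun x => mul_nonneg (by positivity) (hρ0 _)
  have hksupp : ∀ x, x ∉ Metric.closedBall (0 : EuclideanSpace ℝ (Fin d)) ℓ → k x = 0 := by
    intro x hx
    by_contra hne
    apply hx
    have h1 : ρ (ℓ⁻¹ • x) ≠ 0 := fun h => hne (by simp [hkdef, rescale, h])
    have h2 := hρsupp h1
    rw [Metric.mem_ball, dist_zero_right, norm_smul, norm_inv, Real.norm_eq_abs, abs_of_pos hℓ,
      inv_mul_lt_iff₀ hℓ, mul_one] at h2
    rw [Metric.mem_closedBall, dist_zero_right]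
    exact h2.le
  have hkc : HasCompactSupport k :=
    HasCompactSupport.intro (isCompact_closedBall (0 : EuclideanSpace ℝ (Fin d)) ℓ) hksupp
  have hki : Integrable k volume := hk.integrable_of_hasCompactSupport hkc
  have hpow : ℓ ^ (-(d:ℝ)) = (ℓ ^ d)⁻¹ := by
    rw [Real.rpow_neg hℓ.le, Real.rpow_natCast]
  have hk1 : ∫ x, k x = 1 := by
    show ∫ x, ℓ ^ (-(d : ℝ)) * ρ (ℓ⁻¹ • x) = 1
    rw [integral_const_mul, Measure.integral_comp_inv_smul, hρint, hpow]
    have : 0 < ℓ ^ d := by positivity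
    simp [abs_of_pos this, this.ne']
  have hkP : ∀ x, k x ≤ (ℓ ^ d)⁻¹ * P := by
    intro x
    rw [hkdef, rescale, hpow]
    exact mul_le_mul_of_nonneg_left (hP' _) (by positivity)
  -- translated kernels
  have hcx : ∀ x : EuclideanSpace ℝ (Fin d), Continuous fun y => k (x - y) := fun x => by fun_prop
  have hcsx : ∀ x : EuclideanSpace ℝ (Fin d), HasCompactSupport fun y => k (x - y) := fun x =>
    hkc.comp_homeomorph (Homeomorph.subLeft x)
  have hvi : ∀ i, LocallyIntegrable (fun y => v y i) volume := fun i z => by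
    obtain ⟨t, ht, h⟩ := hv z
    exact ⟨t, ht, (EuclideanSpace.proj i : EuclideanSpace ℝ (Fin d) →L[ℝ] ℝ).integrable_comp h⟩
  have hmv : ∀ x i, moll ρ ℓ v x i = ∫ y, k (x - y) * v y i := by
    intro x i
    have := (EuclideanSpace.proj i : EuclideanSpace ℝ (Fin d) →L[ℝ] ℝ).integral_comp_comm
      (hv.integrable_smul_left_of_hasCompactSupport (hcx x) (hcsx x))
    refine Eq.trans ?_ (this.symm.trans ?_)
    · rfl
    · simp
  have hcomm' : ∀ x i j, ∀ M' > M,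
      |moll ρ ℓ v x i * moll ρ ℓ v x j - moll ρ ℓ (fun y => v y i * v y j) x| ≤ C0 * M' ^ 2 := by
    intro x i j M' hM'
    have hM'0 : 0 < M' := hM.trans_lt hM'
    have hb : ∀ i, _ := fun i => aux_jn (hvi i) (by simpa only [sq] using hvv i i) hM'0
      (fun y s hs => (aux_bmo_comp hv hbmo i y s hs).trans
        (mul_le_mul_of_nonneg_right hM'.le (aux_vol_pos y hs).le)) x ℓ hℓ
    have hVl : volume.real (Metric.closedBall x ℓ) = ℓ ^ d * om := by
      have := aux_vol x 0 (t := ℓ) hℓ one_pos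
      rwa [mul_one] at this
    have := aux_comm (hcx x) (hcsx x) (fun y => hk0 _)
      (by rw [integral_sub_left_eq_self (fun y => k y)]; exact hk1) (fun y => hkP _)
      (S := Metric.closedBall x ℓ) measurableSet_closedBall (isCompact_closedBall x ℓ)
      (fun y hy => hksupp _ (fun h => hy (by
        rw [Metric.mem_closedBall, dist_zero_right] at h
        rw [Metric.mem_closedBall, dist_comm, dist_eq_norm]
        exact h)))
      (hvi i) (hvi j) (hvv i i) (hvv j j) (hvv i j) (hb i) (hb j)
    rw [hmv, hmv]
    refine this.trans (le_of_eq ?_)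
    rw [hVl, hC0]
    field_simp
  have hcomm : ∀ x i j,
      |moll ρ ℓ v x i * moll ρ ℓ v x j - moll ρ ℓ (fun y => v y i * v y j) x| ≤ C0 * M ^ 2 := by
    intro x i j
    have hlim : Filter.Tendsto (fun m : ℝ => C0 * m ^ 2) (nhdsWithin M (Set.Ioi M))
        (nhds (C0 * M ^ 2)) := by
      have : Continuous fun m : ℝ => C0 * m ^ 2 := by fun_prop
      exact (this.tendsto M).mono_left nhdsWithin_le_nhds
    exact ge_of_tendsto hlim (by
      filter_upwards [self_mem_nhdsWithin] with m hm using hcomm' x i j m hm)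
  have hsym : ∀ x (i j : Fin d), |(fderiv ℝ (moll ρ ℓ u) x (EuclideanSpace.single i 1)) j +
      (fderiv ℝ (moll ρ ℓ u) x (EuclideanSpace.single j 1)) i| ≤ 18 * ∫ y, k (x - y) ∂ν :=
    fun x i j => aux_sym hk hkc hk0 hu hσ hE x i j
  have hprod : Integrable (Function.uncurry fun x y => k (x - y)) (volume.prod ν) := by
    have hm : AEStronglyMeasurable (Function.uncurry fun x y : EuclideanSpace ℝ (Fin d) => k (x - y))
        (volume.prod ν) :=
      (hk.comp (by fun_prop : Continuous fun z : EuclideanSpace ℝ (Fin d) × EuclideanSpace ℝ (Fin d)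
        => z.1 - z.2)).aestronglyMeasurable
    rw [integrable_prod_iff' hm]
    refine ⟨Filter.Eventually.of_forall fun y => hki.comp_sub_right y, ?_⟩
    have : (fun y => ∫ x, ‖Function.uncurry (fun x y : EuclideanSpace ℝ (Fin d) => k (x - y)) (x, y)‖)
        = fun _ => (1:ℝ) := by
      funext y
      simp only [Function.uncurry, Real.norm_eq_abs, abs_of_nonneg (hk0 _)]
      rw [integral_sub_right_eq_self (fun x => k x), hk1]
    rw [this]
    exact integrable_const _
  have hgi : Integrable (fun x => ∫ y, k (x - y) ∂ν) volume := hprod.integral_prod_left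
  have hg1 : ∫ x, ∫ y, k (x - y) ∂ν = ν.real Set.univ := by
    rw [integral_integral_swap hprod]
    have : ∀ y, ∫ x, k (x - y) = 1 := fun y => by
      rw [integral_sub_right_eq_self (fun x => k x), hk1]
    simp [this]
  set S : ℝ := ∑ i : Fin d, ∑ j : Fin d, C0 * 9 with hS
  have hpt : ∀ x, |∑ i, ∑ j,
          (moll ρ ℓ v x i * moll ρ ℓ v x j - moll ρ ℓ (fun y => v y i * v y j) x) *
            (fderiv ℝ (moll ρ ℓ u) x (EuclideanSpace.single i 1)) j|
      ≤ (S * M ^ 2) * ∫ y, k (x - y) ∂ν := by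
    intro x
    set q : Fin d → Fin d → ℝ := fun i j =>
      moll ρ ℓ v x i * moll ρ ℓ v x j - moll ρ ℓ (fun y => v y i * v y j) x with hq
    set D : Fin d → Fin d → ℝ := fun i j =>
      (fderiv ℝ (moll ρ ℓ u) x (EuclideanSpace.single i 1)) j with hD
    have hqs : ∀ i j, q i j = q j i := by
      intro i j
      simp only [hq]
      rw [mul_comm (moll ρ ℓ v x i)]
      congr 2
      funext y
      ring
    have e1 : ∑ i, ∑ j, q i j * D j i = ∑ i, ∑ j, q i j * D i j := by
      rw [Finset.sum_comm]
      refine Finset.sum_congr rfl fun i _ => Finset.sum_congr rfl fun j _ => ?_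
      rw [hqs]
    have e2 : ∑ i, ∑ j, q i j * D i j = ∑ i, ∑ j, q i j * ((D i j + D j i) / 2) := by
      have : ∑ i, ∑ j, q i j * ((D i j + D j i) / 2) =
          (1/2) * ∑ i, ∑ j, q i j * D i j + (1/2) * ∑ i, ∑ j, q i j * D j i := by
        simp only [Finset.mul_sum, ← Finset.sum_add_distrib]
        refine Finset.sum_congr rfl fun i _ => Finset.sum_congr rfl fun j _ => ?_
        ring
      rw [this, e1]; ring
    show |∑ i, ∑ j, q i j * D i j| ≤ _
    rw [e2, hS, Finset.sum_mul, Finset.sum_mul]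
    refine (Finset.abs_sum_le_sum_abs _ _).trans (Finset.sum_le_sum fun i _ => ?_)
    rw [Finset.sum_mul, Finset.sum_mul]
    refine (Finset.abs_sum_le_sum_abs _ _).trans (Finset.sum_le_sum fun j _ => ?_)
    rw [abs_mul, abs_div, abs_two]
    have h1 : |q i j| ≤ C0 * M ^ 2 := hcomm x i j
    have h2 : |D i j + D j i| / 2 ≤ 9 * ∫ y, k (x - y) ∂ν := by
      have := hsym x i j
      show |D i j + D j i| / 2 ≤ _
      have : |D i j + D j i| ≤ 18 * ∫ y, k (x - y) ∂ν := this
      linarith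
    calc _ ≤ (C0 * M ^ 2) * (9 * ∫ y, k (x - y) ∂ν) :=
          mul_le_mul h1 h2 (by positivity) (by positivity)
      _ = _ := by ring
  have hfin := integral_mono_of_nonneg (μ := volume)
    (Filter.Eventually.of_forall fun x => abs_nonneg _)
    (hgi.const_mul (S * M ^ 2)) (Filter.Eventually.of_forall hpt)
  rw [integral_const_mul, hg1] at hfin
  refine hfin.trans ?_
  show S * M ^ 2 * (ν Set.univ).toReal ≤ _
  gcongr
  linarith

end
end
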